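/- arXiv:1806.10693 — 10 statements merged into one kernel-verified Lean document; each statement's English description precedes it below -/
import Mathlib

section
/- For a Banach space X (over ℝ or ℂ), property (co2) and property (co) are equivalent: X has property (co) if and only if X has property (co2). -/
open Metric Topology

/-- The weak topology on a normed space `E` over `𝕜`. -/
def weakTop (𝕜 E : Type*) [NontriviallyNormedField 𝕜] [NormedAddCommGroup E]
    [NormedSpace 𝕜 E] : TopologicalSpace E :=
  TopologicalSpace.induced (fun (x : E) (f : E →L[𝕜] 𝕜) => f x) inferInstance

/-- `U` is a relatively weakly open subset of the closed unit ball of `E`. -/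
def RelWeakOpen (𝕜 : Type*) {E : Type*} [NontriviallyNormedField 𝕜] [NormedAddCommGroup E]
    [NormedSpace 𝕜 E] (U : Set E) : Prop :=
  U ⊆ closedBall 0 1 ∧ ∃ V : Set E, IsOpen[weakTop 𝕜 E] V ∧ U = V ∩ closedBall 0 1

/-- `x` is an interior point of `C` in the relative weak topology of the closed
unit ball of `E`. -/
def RelWeakInterior (𝕜 : Type*) {E : Type*} [NontriviallyNormedField 𝕜] [NormedAddCommGroup E]
    [NormedSpace 𝕜 E] (C : Set E) (x : E) : Prop :=
  ∃ V : Set E, IsOpen[weakTop 𝕜 E] V ∧ x ∈ V ∧ V ∩ closedBall 0 1 ⊆ C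

/-- The convex combination `∑ j, lam j • U j` of the sets `U j` with coefficients `lam j`. -/
def ConvComb (𝕜 : Type*) {E : Type*} [RCLike 𝕜] [NormedAddCommGroup E] [NormedSpace 𝕜 E]
    {n : ℕ} (lam : Fin n → ℝ) (U : Fin n → Set E) : Set E :=
  {x | ∃ u : Fin n → E, (∀ j, u j ∈ U j) ∧ x = ∑ j, ((lam j : ℝ) : 𝕜) • u j}

/-- `X` has property CWO. -/
def PropCWO (𝕜 E : Type*) [RCLike 𝕜] [NormedAddCommGroup E] [NormedSpace 𝕜 E] : Prop :=
  ∀ (n : ℕ) (U : Fin n → Set E) (lam : Fin n → ℝ),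
    (∀ j, RelWeakOpen 𝕜 (U j)) → (∀ j, 0 < lam j) → (∑ j, lam j) = 1 →
    ∃ V : Set E, IsOpen[weakTop 𝕜 E] V ∧ ConvComb 𝕜 lam U = V ∩ closedBall 0 1

/-- `X` has property CWO-S. -/
def PropCWOS (𝕜 E : Type*) [RCLike 𝕜] [NormedAddCommGroup E] [NormedSpace 𝕜 E] : Prop :=
  ∀ (n : ℕ) (U : Fin n → Set E) (lam : Fin n → ℝ),
    (∀ j, RelWeakOpen 𝕜 (U j)) → (∀ j, 0 < lam j) → (∑ j, lam j) = 1 →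
    ∀ x ∈ ConvComb 𝕜 lam U, ‖x‖ = 1 → RelWeakInterior 𝕜 (ConvComb 𝕜 lam U) x

/-- `X` has property CWO-B. -/
def PropCWOB (𝕜 E : Type*) [RCLike 𝕜] [NormedAddCommGroup E] [NormedSpace 𝕜 E] : Prop :=
  ∀ (n : ℕ) (U : Fin n → Set E) (lam : Fin n → ℝ),
    (∀ j, RelWeakOpen 𝕜 (U j)) → (∀ j, 0 < lam j) → (∑ j, lam j) = 1 →
    ∀ x ∈ ConvComb 𝕜 lam U, ‖x‖ < 1 → RelWeakInterior 𝕜 (ConvComb 𝕜 lam U) x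

/-- A point `x` of the closed unit ball has property (co n). -/
def HasCoN (𝕜 : Type*) {E : Type*} [RCLike 𝕜] [NormedAddCommGroup E] [NormedSpace 𝕜 E]
    (n : ℕ) (x : E) : Prop :=
  ∀ (xs : Fin n → E) (lam : Fin n → ℝ),
    (∀ j, ‖xs j‖ ≤ 1) → (∀ j, 0 < lam j) → (∑ j, lam j) = 1 →
    x = (∑ j, ((lam j : ℝ) : 𝕜) • xs j) →
    ∀ ε : ℝ, 0 < ε → ∃ δ : ℝ, 0 < δ ∧
      ∃ v : Fin n → ((ball x δ ∩ closedBall 0 1 : Set E) → E),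
        (∀ j, Continuous (v j)) ∧
        ∀ u : (ball x δ ∩ closedBall 0 1 : Set E),
          (∀ j, ‖v j u‖ ≤ 1) ∧
          (u : E) = (∑ j, ((lam j : ℝ) : 𝕜) • v j u) ∧
          ∀ j, ‖v j u - xs j‖ < ε

/-- A point `x` of the closed unit ball has property (co). -/
def HasCoPt (𝕜 : Type*) {E : Type*} [RCLike 𝕜] [NormedAddCommGroup E] [NormedSpace 𝕜 E]
    (x : E) : Prop :=
  ∀ n : ℕ, 2 ≤ n → HasCoN 𝕜 n x

/-- The space has property (co). -/
def PropCo (𝕜 E : Type*) [RCLike 𝕜] [NormedAddCommGroup E] [NormedSpace 𝕜 E] : Prop :=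
  ∀ x : E, ‖x‖ ≤ 1 → HasCoPt 𝕜 x

/-- `x` is an extreme point of the closed unit ball of `E`
(with respect to the real convex structure). -/
def IsExtremePt (𝕜 : Type*) {E : Type*} [RCLike 𝕜] [NormedAddCommGroup E] [NormedSpace 𝕜 E]
    (x : E) : Prop :=
  ‖x‖ ≤ 1 ∧ ∀ y z : E, ‖y‖ ≤ 1 → ‖z‖ ≤ 1 → ∀ t : ℝ, 0 < t → t < 1 →
    x = ((t : ℝ) : 𝕜) • y + (((1 - t : ℝ) : ℝ) : 𝕜) • z → y = x ∧ z = x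

/-- A topological space is scattered if every non-empty subset `A` has a point
isolated in `A`. -/
def Scattered (K : Type*) [TopologicalSpace K] : Prop :=
  ∀ A : Set K, A.Nonempty → ∃ a ∈ A, ∃ U : Set K, IsOpen U ∧ U ∩ A = {a}


/-- For a Banach space, property (co) and property (co2) are equivalent. -/
theorem stmt9 {𝕜 E : Type*} [RCLike 𝕜] [NormedAddCommGroup E] [NormedSpace 𝕜 E]
    [CompleteSpace E] :
    PropCo 𝕜 E ↔ (∀ x : E, ‖x‖ ≤ 1 → HasCoN 𝕜 2 x) := by
  constructor
  · intro h x hx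
    exact h x hx 2 le_rfl
  · intro h x hx n hn
    induction n, hn using Nat.le_induction generalizing x with
    | base => exact h x hx
    | succ n hn ih =>
      intro xs lam hxs hlam hsum hxe ε hε
      have hS : 0 < ∑ j : Fin n, lam j.succ :=
        Finset.sum_pos (fun j _ => hlam _) ⟨⟨0, by omega⟩, Finset.mem_univ _⟩
      set s : ℝ := ∑ j : Fin n, lam j.succ with hs
      have hsum' : lam 0 + s = 1 := by rw [← hsum, Fin.sum_univ_succ]
      have hs0 : s ≠ 0 := hS.ne'
      have hsk : (s : 𝕜) ≠ 0 := by exact_mod_cast hs0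
      set y : E := ∑ j : Fin n, ((lam j.succ / s : ℝ) : 𝕜) • xs j.succ with hy
      have hμ : ∑ j : Fin n, lam j.succ / s = 1 := by
        rw [← Finset.sum_div, ← hs, div_self hs0]
      have hy1 : ‖y‖ ≤ 1 := by
        calc ‖y‖ ≤ ∑ j : Fin n, ‖((lam j.succ / s : ℝ) : 𝕜) • xs j.succ‖ := norm_sum_le _ _
          _ ≤ ∑ j : Fin n, lam j.succ / s := by
            refine Finset.sum_le_sum fun j _ => ?_
            have hp : 0 < lam j.succ / s := div_pos (hlam _) hS
            rw [norm_smul, RCLike.norm_ofReal, abs_of_pos hp]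
            exact mul_le_of_le_one_right hp.le (hxs _)
          _ = 1 := hμ
      have key : ∀ z : Fin n → E, (s : 𝕜) • ∑ j, ((lam j.succ / s : ℝ) : 𝕜) • z j
          = ∑ j, ((lam j.succ : ℝ) : 𝕜) • z j := by
        intro z
        rw [Finset.smul_sum]
        refine Finset.sum_congr rfl fun j _ => ?_
        rw [smul_smul, RCLike.ofReal_div, mul_div_cancel₀ _ hsk]
      obtain ⟨δ', hδ', w, hwc, hw⟩ := ih y hy1 (fun j => xs j.succ) (fun j => lam j.succ / s)
        (fun j => hxs _) (fun j => div_pos (hlam _) hS) hμ rfl ε hε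
      obtain ⟨δ, hδ, v, hvc, hv⟩ := h x hx ![xs 0, y] ![lam 0, s]
        (by intro j; fin_cases j; exacts [hxs 0, hy1])
        (by intro j; fin_cases j; exacts [hlam 0, hS])
        (by simpa [Fin.sum_univ_two] using hsum')
        (by
          rw [Fin.sum_univ_two, hxe, Fin.sum_univ_succ]
          simp only [Matrix.cons_val_zero, Matrix.cons_val_one]
          rw [hy, key])
        (min ε δ') (lt_min hε hδ')
      have hmem : ∀ u, v 1 u ∈ (ball y δ' ∩ closedBall 0 1 : Set E) := by
        intro u
        refine ⟨?_, ?_⟩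
        · rw [mem_ball_iff_norm]
          exact lt_of_lt_of_le ((hv u).2.2 1) (min_le_right _ _)
        · rw [mem_closedBall_zero_iff]
          exact (hv u).1 1
      refine ⟨δ, hδ, Fin.cons (v 0) (fun j u => w j ⟨v 1 u, hmem u⟩), ?_, ?_⟩
      · intro j
        refine Fin.cases ?_ (fun j => ?_) j
        · exact hvc 0
        · exact (hwc j).comp ((hvc 1).subtype_mk hmem)
      · intro u
        refine ⟨fun j => ?_, ?_, fun j => ?_⟩
        · refine Fin.cases ?_ (fun j => ?_) j
          · exact (hv u).1 0
          · exact (hw _).1 j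
        · have h1 := (hv u).2.1
          have h2 := (hw ⟨v 1 u, hmem u⟩).2.1
          rw [Fin.sum_univ_two] at h1
          simp only [Matrix.cons_val_zero, Matrix.cons_val_one] at h1
          simp only at h2
          rw [Fin.sum_univ_succ]
          simp only [Fin.cons_zero, Fin.cons_succ]
          rw [← key, ← h2]
          exact h1
        · refine Fin.cases ?_ (fun j => ?_) j
          · exact lt_of_lt_of_le ((hv u).2.2 0) (min_le_left _ _)
          · exact (hw _).2.2 j
end

section
/- Let X be a Banach space (over ℝ or ℂ). Suppose there is a point x ∈ S_X such that x is not an extreme point of B_X and, for every ε > 0, the ball B(x,ε) contains an extreme point of B_X. Then: (1) x fails property (co2); and (2) X fails property CWO-S. -/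
open Metric Topology

theorem aux_split {𝕜 E : Type*} [RCLike 𝕜] [NormedAddCommGroup E] [NormedSpace 𝕜 E]
    (x : E) (hx : ‖x‖ = 1) (hnotext : ¬ IsExtremePt 𝕜 x) :
    ∃ y z : E, ‖y‖ ≤ 1 ∧ ‖z‖ ≤ 1 ∧ y ≠ z ∧ ∃ t : ℝ, 0 < t ∧ t < 1 ∧
      x = ((t : ℝ) : 𝕜) • y + (((1 - t : ℝ) : ℝ) : 𝕜) • z := by
  by_contra hcon
  apply hnotext
  refine ⟨hx.le, fun y z hy hz t ht ht1 h => ?_⟩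
  by_cases hyz : y = z
  · subst hyz
    have : x = y := by
      rw [h, ← add_smul, ← RCLike.ofReal_add]
      simp
    exact ⟨this.symm, this.symm⟩
  · exact absurd ⟨y, z, hy, hz, hyz, t, ht, ht1, h⟩ hcon

theorem aux_weak_open {𝕜 E : Type*} [RCLike 𝕜] [NormedAddCommGroup E] [NormedSpace 𝕜 E]
    {V : Set E} (hV : IsOpen[weakTop 𝕜 E] V) : IsOpen V := by
  obtain ⟨W, hW, rfl⟩ := isOpen_induced_iff.mp hV
  exact hW.preimage (continuous_pi fun f => f.continuous)

theorem aux_relopen {𝕜 E : Type*} [RCLike 𝕜] [NormedAddCommGroup E] [NormedSpace 𝕜 E]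
    (f : E →L[𝕜] 𝕜) (c : 𝕜) (r : ℝ) :
    RelWeakOpen 𝕜 ((f ⁻¹' ball c r) ∩ closedBall (0 : E) 1) := by
  refine ⟨Set.inter_subset_right, f ⁻¹' ball c r, ?_, rfl⟩
  exact isOpen_induced_iff.mpr
    ⟨(fun g : (E →L[𝕜] 𝕜) → 𝕜 => g f) ⁻¹' ball c r,
      isOpen_ball.preimage (continuous_apply f), rfl⟩

/-- If `x ∈ S_X` is not an extreme point of `B_X` but extreme points of
`B_X` come arbitrarily close to `x`, then `x` fails property (co2) and `X` fails
property CWO-S. -/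
theorem stmt10 {𝕜 E : Type*} [RCLike 𝕜] [NormedAddCommGroup E] [NormedSpace 𝕜 E]
    [CompleteSpace E] (x : E) (hx : ‖x‖ = 1) (hnotext : ¬ IsExtremePt 𝕜 x)
    (hclose : ∀ ε : ℝ, 0 < ε → ∃ y : E, IsExtremePt 𝕜 y ∧ ‖y - x‖ < ε) :
    ¬ HasCoN 𝕜 2 x ∧ ¬ PropCWOS 𝕜 E := by
  obtain ⟨y, z, hy, hz, hyz, t, ht, ht1, hxt⟩ := aux_split (𝕜 := 𝕜) x hx hnotext
  have hpos : ∀ j : Fin 2, 0 < (![t, 1 - t] : Fin 2 → ℝ) j := by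
    intro j
    fin_cases j
    · simpa using ht
    · simpa using ht1
  have hsum : ∑ j, (![t, 1 - t] : Fin 2 → ℝ) j = 1 := by
    simp [Fin.sum_univ_two]
  constructor
  · intro hco
    have hn : 0 < ‖y - z‖ := norm_pos_iff.mpr (sub_ne_zero.mpr hyz)
    obtain ⟨δ, hδ, v, -, hv⟩ := hco ![y, z] ![t, 1 - t]
      (by intro j; fin_cases j <;> simpa) hpos hsum
      (by rw [Fin.sum_univ_two]; exact hxt) (‖y - z‖ / 2) (half_pos hn)
    obtain ⟨e, he, hex⟩ := hclose δ hδ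
    obtain ⟨h1, h2, h3⟩ := hv ⟨e, by
      refine ⟨?_, ?_⟩
      · rwa [mem_ball, dist_eq_norm]
      · simpa using he.1⟩
    rw [Fin.sum_univ_two] at h2
    obtain ⟨e0, e1⟩ := he.2 _ _ (h1 0) (h1 1) t ht ht1 h2
    have a0 := h3 0
    have a1 := h3 1
    rw [e0] at a0
    rw [e1] at a1
    change ‖e - y‖ < _ at a0
    change ‖e - z‖ < _ at a1
    have := norm_sub_le (e - z) (e - y)
    rw [sub_sub_sub_cancel_left] at this
    linarith
  · intro hcwo
    obtain ⟨f, hf⟩ : ∃ f : E →L[𝕜] 𝕜, f y ≠ f z := by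
      by_contra hcon
      push Not at hcon
      exact hyz ((NormedSpace.eq_iff_forall_dual_eq 𝕜).mpr hcon)
    have hn : 0 < dist (f y) (f z) := dist_pos.mpr hf
    set r := dist (f y) (f z) / 2 with hr
    have hr0 : 0 < r := half_pos hn
    obtain ⟨V, hV, hxV, hVC⟩ := hcwo 2
      ![(f ⁻¹' ball (f y) r) ∩ closedBall (0 : E) 1, (f ⁻¹' ball (f z) r) ∩ closedBall (0 : E) 1]
      ![t, 1 - t]
      (by intro j; fin_cases j
          · exact aux_relopen f (f y) r
          · exact aux_relopen f (f z) r) hpos hsum x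
      (by
        refine ⟨![y, z], ?_, ?_⟩
        · intro j; fin_cases j
          · exact ⟨mem_ball_self hr0, by simpa using hy⟩
          · exact ⟨mem_ball_self hr0, by simpa using hz⟩
        · rw [Fin.sum_univ_two]; exact hxt) hx
    obtain ⟨δ, hδ, hball⟩ := Metric.isOpen_iff.mp (aux_weak_open hV) x hxV
    obtain ⟨e, he, hex⟩ := hclose δ hδ
    obtain ⟨u, hu, hue⟩ := hVC ⟨hball (by rwa [mem_ball, dist_eq_norm]),
      (by simpa using he.1 : e ∈ closedBall (0 : E) 1)⟩
    rw [Fin.sum_univ_two] at hue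
    have u0 : u 0 ∈ (f ⁻¹' ball (f y) r) ∩ closedBall (0 : E) 1 := hu 0
    have u1 : u 1 ∈ (f ⁻¹' ball (f z) r) ∩ closedBall (0 : E) 1 := hu 1
    obtain ⟨e0, e1⟩ := he.2 _ _ (by simpa using u0.2) (by simpa using u1.2) t ht ht1 hue
    rw [e0] at u0
    rw [e1] at u1
    have a0 : dist (f e) (f y) < r := u0.1
    have a1 : dist (f e) (f z) < r := u1.1
    have := dist_triangle_left (f y) (f z) (f e)
    linarith
end

section
/- Let X be a finite dimensional Banach space over 𝕂 (𝕂 = ℝ or ℂ) such that its dual X* is polyhedral, i.e., there exists a finite set A ⊆ ext B_{X*} such that ext B_{X*} = {α·φ : α ∈ 𝕂, |α| = 1, φ ∈ A}. Then X has property (co2), and hence property (co). -/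
open Metric Topology

lemma aux_norm {𝕜 E : Type*} [RCLike 𝕜] [NormedAddCommGroup E] [NormedSpace 𝕜 E]
    [FiniteDimensional 𝕜 E] (A : Finset (E →L[𝕜] 𝕜))
    (hpoly : ∀ ψ : E →L[𝕜] 𝕜,
      IsExtremePt 𝕜 ψ ↔ ∃ α : 𝕜, ‖α‖ = 1 ∧ ∃ φ ∈ A, ψ = α • φ)
    (y : E) (hy : ∀ φ ∈ A, ‖φ y‖ ≤ 1) : ‖y‖ ≤ 1 := by
  have : FiniteDimensional 𝕜 (E →L[𝕜] 𝕜) := inferInstance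
  have : ProperSpace (E →L[𝕜] 𝕜) := FiniteDimensional.proper_rclike 𝕜 _
  set F : Set (E →L[𝕜] 𝕜) := {f | ‖f‖ ≤ 1 ∧ RCLike.re (f y) = ‖y‖} with hF
  have hre : ∀ f : E →L[𝕜] 𝕜, ‖f‖ ≤ 1 → RCLike.re (f y) ≤ ‖y‖ := fun f hf =>
    (RCLike.re_le_norm _).trans
      ((f.le_opNorm y).trans (mul_le_of_le_one_left (norm_nonneg _) hf))
  have hcl : IsClosed {f : E →L[𝕜] 𝕜 | RCLike.re (f y) = ‖y‖} := by
    apply isClosed_eq _ continuous_const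
    exact RCLike.continuous_re.comp (ContinuousLinearMap.apply 𝕜 𝕜 y).continuous
  have hcomp : IsCompact F := by
    have h := (isCompact_closedBall (0 : E →L[𝕜] 𝕜) 1).inter_right hcl
    have e : F = closedBall 0 1 ∩ {f | RCLike.re (f y) = ‖y‖} := by
      ext f
      simp [hF]
    rw [e]
    exact h
  have hne : F.Nonempty := by
    obtain ⟨g, hg, hgy⟩ := exists_dual_vector'' 𝕜 y
    exact ⟨g, hg, by rw [hgy]; simp⟩
  obtain ⟨ψ, hψ⟩ := hcomp.extremePoints_nonempty hne
  have hψF : ψ ∈ F := hψ.1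
  have hext : IsExtremePt 𝕜 ψ := by
    refine ⟨hψF.1, fun f g hf hg t ht0 ht1 h => ?_⟩
    have h1 : RCLike.re (ψ y) = t * RCLike.re (f y) + (1 - t) * RCLike.re (g y) := by
      rw [h]
      simp only [ContinuousLinearMap.add_apply, ContinuousLinearMap.smul_apply, smul_eq_mul,
        map_add, RCLike.re_ofReal_mul]
    rw [hψF.2] at h1
    have hf' := hre f hf
    have hg' := hre g hg
    have e1 : RCLike.re (f y) = ‖y‖ := by nlinarith
    have e2 : RCLike.re (g y) = ‖y‖ := by nlinarith
    have := (mem_extremePoints.1 hψ).2 f ⟨hf, e1⟩ g ⟨hg, e2⟩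
      ⟨t, 1 - t, ht0, by linarith, by ring, by
        rw [h]; ext z
        simp [RCLike.real_smul_eq_coe_mul]⟩
    exact this
  obtain ⟨α, hα, φ, hφ, rfl⟩ := (hpoly ψ).1 hext
  have h2 := hψF.2
  rw [← h2]
  refine (RCLike.re_le_norm _).trans ?_
  simpa [hα] using hy φ hφ

lemma aux_strict {𝕜 : Type*} [RCLike 𝕜] {n : ℕ} (a : Fin n → 𝕜) (lam : Fin n → ℝ) (c : 𝕜)
    (ha : ∀ j, ‖a j‖ ≤ 1) (hl : ∀ j, 0 < lam j) (hs : ∑ j, lam j = 1) (hc : ‖c‖ = 1)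
    (h : c = ∑ j, ((lam j : ℝ) : 𝕜) * a j) : ∀ j, a j = c := by
  have h0 : ∑ j, lam j * ‖a j - c‖ ^ 2 ≤ 0 := by
    have hr : ∑ j, lam j * RCLike.re (inner 𝕜 c (a j)) = 1 := by
      have : inner 𝕜 c c = ∑ j, ((lam j : ℝ) : 𝕜) * inner 𝕜 c (a j) := by
        conv_lhs => arg 3; rw [h]
        rw [inner_sum]
        refine Finset.sum_congr rfl fun j _ => ?_
        rw [← smul_eq_mul, inner_smul_right]
      have h3 := congrArg RCLike.re this
      rw [inner_self_eq_norm_sq, hc, map_sum] at h3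
      simp only [RCLike.re_ofReal_mul] at h3
      rw [← h3]; norm_num
    calc ∑ j, lam j * ‖a j - c‖ ^ 2
        ≤ ∑ j, (2 * lam j - 2 * (lam j * RCLike.re (inner 𝕜 c (a j)))) := by
          refine Finset.sum_le_sum fun j _ => ?_
          rw [norm_sub_rev, @norm_sub_sq 𝕜, hc]
          have : ‖a j‖ ^ 2 ≤ 1 := pow_le_one₀ (norm_nonneg _) (ha j)
          nlinarith [hl j]
      _ = 0 := by
          rw [Finset.sum_sub_distrib, ← Finset.mul_sum, ← Finset.mul_sum, hs, hr]; norm_num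
  have hnn : ∀ j ∈ Finset.univ, 0 ≤ lam j * ‖a j - c‖ ^ 2 := fun j _ =>
    mul_nonneg (hl j).le (sq_nonneg _)
  intro j
  have := (Finset.sum_eq_zero_iff_of_nonneg hnn).1
    (le_antisymm h0 (Finset.sum_nonneg hnn)) j (Finset.mem_univ j)
  rcases mul_eq_zero.1 this with h4 | h4
  · exact absurd h4 (hl j).ne'
  · exact sub_eq_zero.1 (norm_eq_zero.1 (pow_eq_zero_iff two_ne_zero |>.1 h4))

lemma aux_gap {ι : Type*} (A : Finset ι) (f : ι → ℝ) :
    ∃ m : ℝ, 0 < m ∧ ∀ i ∈ A, f i < 1 → f i ≤ 1 - m := by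
  classical
  induction A using Finset.induction_on with
  | empty => exact ⟨1, one_pos, by simp⟩
  | insert a s _ ih =>
    obtain ⟨m, hm, h⟩ := ih
    by_cases ha : f a < 1
    · refine ⟨min m (1 - f a), lt_min hm (by linarith), fun i hi hi1 => ?_⟩
      rcases Finset.mem_insert.1 hi with rfl | hi
      · linarith [min_le_right m (1 - f i)]
      · linarith [min_le_left m (1 - f a), h i hi hi1]
    · refine ⟨m, hm, fun i hi hi1 => ?_⟩
      rcases Finset.mem_insert.1 hi with rfl | hi
      · exact absurd hi1 ha
      · exact h i hi hi1

lemma aux_main {𝕜 E : Type*} [RCLike 𝕜] [NormedAddCommGroup E] [NormedSpace 𝕜 E]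
    [FiniteDimensional 𝕜 E] (A : Finset (E →L[𝕜] 𝕜))
    (hA : ∀ φ ∈ A, IsExtremePt 𝕜 φ)
    (hpoly : ∀ ψ : E →L[𝕜] 𝕜,
      IsExtremePt 𝕜 ψ ↔ ∃ α : 𝕜, ‖α‖ = 1 ∧ ∃ φ ∈ A, ψ = α • φ)
    (x : E) (hx : ‖x‖ ≤ 1) (n : ℕ) : HasCoN 𝕜 n x := by
  intro xs lam hxs hl hs hxe ε hε
  obtain ⟨m, hm, hgap⟩ := aux_gap A (fun φ => ‖φ x‖)
  have hle : ∀ φ ∈ A, ∀ z : E, ‖φ z‖ ≤ ‖z‖ := fun φ hφ z =>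
    (φ.le_opNorm z).trans (mul_le_of_le_one_left (norm_nonneg _) (hA φ hφ).1)
  obtain ⟨t, ht0, ht1, htε⟩ : ∃ t : ℝ, 0 < t ∧ t ≤ 1 ∧ t * 2 ≤ ε / 2 :=
    ⟨min 1 (ε / 4), lt_min one_pos (by linarith), min_le_left _ _, by
      linarith [min_le_right 1 (ε / 4)]⟩
  have hsk : ∑ j, ((lam j : ℝ) : 𝕜) = 1 := by
    rw [← RCLike.ofReal_sum, hs, RCLike.ofReal_one]
  refine ⟨min (ε / 2) (t * m), lt_min (by linarith) (mul_pos ht0 hm),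
    fun j u => xs j + (t : 𝕜) • (x - xs j) + ((u : E) - x), fun j => by fun_prop, fun u => ?_⟩
  have hu1 : ‖(u : E)‖ ≤ 1 := by simpa using u.2.2
  have hu2 : ‖(u : E) - x‖ < min (ε / 2) (t * m) := by
    have := u.2.1
    rwa [mem_ball, dist_eq_norm] at this
  have hu3 := hu2.trans_le (min_le_left _ _)
  have hu4 := hu2.trans_le (min_le_right _ _)
  have htn : ‖(t : 𝕜)‖ = t := by rw [RCLike.norm_ofReal, abs_of_pos ht0]
  have htn' : ‖(1 - t : 𝕜)‖ = 1 - t := by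
    rw [← RCLike.ofReal_one, ← RCLike.ofReal_sub, RCLike.norm_ofReal, abs_of_nonneg (by linarith)]
  refine ⟨fun j => aux_norm A hpoly _ fun φ hφ => ?_, ?_, fun j => ?_⟩
  · by_cases h1 : ‖φ x‖ < 1
    · have hg := hgap φ hφ h1
      have e : φ (xs j + (t : 𝕜) • (x - xs j) + ((u : E) - x))
          = (1 - t : 𝕜) * φ (xs j) + (t : 𝕜) * φ x + φ ((u : E) - x) := by
        simp only [map_add, map_smul, map_sub, smul_eq_mul]; ring
      rw [e]
      refine (norm_add₃_le).trans ?_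
      rw [norm_mul, norm_mul, htn, htn']
      have h5 := (hle φ hφ (xs j)).trans (hxs j)
      have h6 := hle φ hφ ((u : E) - x)
      nlinarith
    · have hc : ‖φ x‖ = 1 := le_antisymm ((hle φ hφ x).trans hx) (not_lt.1 h1)
      have h7 := aux_strict (fun j => φ (xs j)) lam (φ x)
        (fun j => (hle φ hφ _).trans (hxs j)) hl hs hc (by
          conv_lhs => rw [hxe]
          simp) j
      have e : φ (xs j + (t : 𝕜) • (x - xs j) + ((u : E) - x)) = φ u := by
        simp only [map_add, map_smul, map_sub, smul_eq_mul, h7]; ring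
      rw [e]
      exact (hle φ hφ _).trans hu1
  · simp only [smul_add, smul_sub, Finset.sum_add_distrib, Finset.sum_sub_distrib]
    simp only [smul_comm _ (t : 𝕜), ← Finset.smul_sum, ← Finset.sum_smul, ← hxe, hsk, one_smul]
    abel
  · have e : xs j + (t : 𝕜) • (x - xs j) + ((u : E) - x) - xs j
        = (t : 𝕜) • (x - xs j) + ((u : E) - x) := by abel
    rw [e]
    refine (norm_add_le _ _).trans_lt ?_
    rw [norm_smul, htn]
    have : ‖x - xs j‖ ≤ 2 := (norm_sub_le _ _).trans (by linarith [hxs j])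
    nlinarith

/-- If `X` is finite dimensional and its dual is polyhedral
(the extreme points of `B_{X*}` are `𝕋 ⬝ A` for a finite set `A`), then `X` has
property (co2), and hence property (co). -/
theorem stmt12 {𝕜 E : Type*} [RCLike 𝕜] [NormedAddCommGroup E] [NormedSpace 𝕜 E]
    [FiniteDimensional 𝕜 E] (A : Finset (E →L[𝕜] 𝕜))
    (hA : ∀ φ ∈ A, IsExtremePt 𝕜 φ)
    (hpoly : ∀ ψ : E →L[𝕜] 𝕜,
      IsExtremePt 𝕜 ψ ↔ ∃ α : 𝕜, ‖α‖ = 1 ∧ ∃ φ ∈ A, ψ = α • φ) :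
    (∀ x : E, ‖x‖ ≤ 1 → HasCoN 𝕜 2 x) ∧ PropCo 𝕜 E := by
  exact ⟨fun x hx => aux_main A hA hpoly x hx 2, fun x hx n _ => aux_main A hA hpoly x hx n⟩
end

section
/- Let X be a Banach space (over ℝ or ℂ) and let x ∈ S_X. Then x has property (co2) if and only if: whenever x_1, x_2 ∈ S_X with x_1 ≠ x_2 and λ_1, λ_2 > 0 with λ_1 + λ_2 = 1 are such that x = λ_1 x_1 + λ_2 x_2, and ε > 0, there is δ > 0 such that, setting S := B(x,δ) ∩ S_X, there are continuous functions 𝔳_1, 𝔳_2 : S → B_X such that, for every u ∈ S, u = λ_1 𝔳_1(u) + λ_2 𝔳_2(u) and ‖𝔳_j(u) − x_j‖ < ε for j ∈ {1,2}. -/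
open Metric Topology

/-- A norm-one point `x` has property (co2) if and only if the analogous
splitting condition holds with the domain of the splitting functions being a
neighbourhood of `x` on the unit sphere (and with distinct norm-one points `x₁ ≠ x₂`). -/
theorem stmt13 {𝕜 E : Type*} [RCLike 𝕜] [NormedAddCommGroup E] [NormedSpace 𝕜 E]
    [CompleteSpace E] (x : E) (hx : ‖x‖ = 1) :
    HasCoN 𝕜 2 x ↔
      ∀ (x₁ x₂ : E), ‖x₁‖ = 1 → ‖x₂‖ = 1 → x₁ ≠ x₂ →
        ∀ lam₁ lam₂ : ℝ, 0 < lam₁ → 0 < lam₂ → lam₁ + lam₂ = 1 →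
          x = ((lam₁ : ℝ) : 𝕜) • x₁ + ((lam₂ : ℝ) : 𝕜) • x₂ →
          ∀ ε : ℝ, 0 < ε → ∃ δ : ℝ, 0 < δ ∧
            ∃ v₁ v₂ : (Metric.ball x δ ∩ Metric.sphere (0 : E) 1 : Set E) → E,
              Continuous v₁ ∧ Continuous v₂ ∧
              ∀ u : (Metric.ball x δ ∩ Metric.sphere (0 : E) 1 : Set E),
                ‖v₁ u‖ ≤ 1 ∧ ‖v₂ u‖ ≤ 1 ∧
                (u : E) = ((lam₁ : ℝ) : 𝕜) • v₁ u + ((lam₂ : ℝ) : 𝕜) • v₂ u ∧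
                ‖v₁ u - x₁‖ < ε ∧ ‖v₂ u - x₂‖ < ε := by
  constructor
  · intro h x₁ x₂ h1 h2 _ l₁ l₂ hl1 hl2 hl hxe ε hε
    obtain ⟨δ, hδ, v, hvc, hv⟩ := h ![x₁, x₂] ![l₁, l₂]
      (by intro j; fin_cases j <;> simp [h1, h2])
      (by intro j; fin_cases j <;> simp [hl1, hl2])
      (by simp [Fin.sum_univ_two, hl])
      (by simpa [Fin.sum_univ_two] using hxe) ε hε
    have hsub : (Metric.ball x δ ∩ Metric.sphere (0 : E) 1 : Set E) ⊆
        (ball x δ ∩ closedBall 0 1 : Set E) :=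
      Set.inter_subset_inter_right _ sphere_subset_closedBall
    refine ⟨δ, hδ, fun u => v 0 (Set.inclusion hsub u), fun u => v 1 (Set.inclusion hsub u),
      (hvc 0).comp (continuous_inclusion hsub), (hvc 1).comp (continuous_inclusion hsub), ?_⟩
    intro u
    obtain ⟨ha, hb, hc⟩ := hv (Set.inclusion hsub u)
    refine ⟨ha 0, ha 1, ?_, ?_, ?_⟩
    · simpa [Fin.sum_univ_two] using hb
    · simpa using hc 0
    · simpa using hc 1
  · intro h xs lam hxs hlam hsum hxe ε hε
    rw [Fin.sum_univ_two] at hsum hxe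
    have hl0 := hlam 0
    have hl1 := hlam 1
    have ha := hxs 0
    have hb := hxs 1
    have hn : 1 ≤ lam 0 * ‖xs 0‖ + lam 1 * ‖xs 1‖ := by
      calc (1 : ℝ) = ‖((lam 0 : ℝ) : 𝕜) • xs 0 + ((lam 1 : ℝ) : 𝕜) • xs 1‖ := by
            rw [← hxe, hx]
        _ ≤ _ := norm_add_le _ _
        _ = _ := by
            rw [norm_smul, norm_smul, RCLike.norm_ofReal, RCLike.norm_ofReal,
              abs_of_pos hl0, abs_of_pos hl1]
    have h1 : ‖xs 0‖ = 1 := by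
      refine le_antisymm ha ?_
      nlinarith
    have h2 : ‖xs 1‖ = 1 := by
      refine le_antisymm hb ?_
      nlinarith
    have hs' : ((lam 0 : ℝ) : 𝕜) + ((lam 1 : ℝ) : 𝕜) = 1 := by
      rw [← RCLike.ofReal_add, hsum, RCLike.ofReal_one]
    by_cases hne : xs 0 = xs 1
    · have hx0 : x = xs 0 := by
        rw [hxe, ← hne, ← add_smul, hs', one_smul]
      refine ⟨ε, hε, fun _ u => (u : E), fun _ => continuous_subtype_val, ?_⟩
      intro u
      refine ⟨fun _ => by simpa using u.2.2, ?_, ?_⟩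
      · rw [Fin.sum_univ_two, ← add_smul, hs', one_smul]
      · have hu : ‖(u : E) - x‖ < ε := by simpa [dist_eq_norm] using u.2.1
        intro j
        fin_cases j
        · simpa [← hx0] using hu
        · simpa [← hne, ← hx0] using hu
    · obtain ⟨δ, hδ, v₁, v₂, hc1, hc2, hv⟩ :=
        h (xs 0) (xs 1) h1 h2 hne (lam 0) (lam 1) hl0 hl1 hsum hxe (ε / 2) (by linarith)
      obtain ⟨η, hη, hη1, hη2, hη3⟩ : ∃ η : ℝ, 0 < η ∧ η ≤ δ / 2 ∧ η ≤ ε / 2 ∧ η ≤ 1 / 2 :=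
        ⟨min (δ / 2) (min (ε / 2) (1 / 2)), by positivity, min_le_left _ _,
          (min_le_right _ _).trans (min_le_left _ _),
          (min_le_right _ _).trans (min_le_right _ _)⟩
      have key : ∀ u : (ball x η ∩ closedBall 0 1 : Set E),
          ‖(u : E) - x‖ < η ∧ ‖(u : E)‖ ≤ 1 ∧ 1 - ‖(u : E)‖ < η ∧ 0 < ‖(u : E)‖ := by
        intro u
        have hu : ‖(u : E) - x‖ < η := by simpa [dist_eq_norm] using u.2.1
        have hu1 : ‖(u : E)‖ ≤ 1 := by simpa using u.2.2
        have := norm_sub_norm_le x (u : E)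
        rw [norm_sub_rev, hx] at this
        exact ⟨hu, hu1, by linarith, by linarith⟩
      have hmem : ∀ u : (ball x η ∩ closedBall 0 1 : Set E),
          ((‖(u : E)‖ : ℝ) : 𝕜)⁻¹ • (u : E) ∈
            (Metric.ball x δ ∩ Metric.sphere (0 : E) 1 : Set E) := by
        intro u
        obtain ⟨k1, k2, k3, k4⟩ := key u
        have hw : ‖((‖(u : E)‖ : ℝ) : 𝕜)⁻¹ • (u : E)‖ = 1 := by
          rw [norm_smul, norm_inv, RCLike.norm_ofReal, abs_norm, inv_mul_cancel₀ k4.ne']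
        have hc0 : ((‖(u : E)‖ : ℝ) : 𝕜) ≠ 0 := by exact_mod_cast k4.ne'
        refine ⟨?_, by simpa only [mem_sphere_zero_iff_norm] using hw⟩
        rw [mem_ball, dist_eq_norm]
        have e1 : ((‖(u : E)‖ : ℝ) : 𝕜)⁻¹ • (u : E) - (u : E) =
            ((1 - ‖(u : E)‖ : ℝ) : 𝕜) • (((‖(u : E)‖ : ℝ) : 𝕜)⁻¹ • (u : E)) := by
          rw [RCLike.ofReal_sub, RCLike.ofReal_one, sub_smul, one_smul, smul_inv_smul₀ hc0]
        have e2 : ‖((‖(u : E)‖ : ℝ) : 𝕜)⁻¹ • (u : E) - (u : E)‖ = 1 - ‖(u : E)‖ := by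
          rw [e1, norm_smul, hw, mul_one, RCLike.norm_ofReal, abs_of_nonneg (by linarith)]
        have e3 := norm_sub_le_norm_sub_add_norm_sub
          (((‖(u : E)‖ : ℝ) : 𝕜)⁻¹ • (u : E)) (u : E) x
        linarith
      let w : (ball x η ∩ closedBall 0 1 : Set E) →
          (Metric.ball x δ ∩ Metric.sphere (0 : E) 1 : Set E) := fun u => ⟨_, hmem u⟩
      have hcn : Continuous fun u : (ball x η ∩ closedBall 0 1 : Set E) =>
          ((‖(u : E)‖ : ℝ) : 𝕜) :=
        RCLike.continuous_ofReal.comp (continuous_norm.comp continuous_subtype_val)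
      have hw : Continuous w := by
        refine Continuous.subtype_mk (Continuous.smul (hcn.inv₀ ?_) continuous_subtype_val) _
        intro u
        exact_mod_cast (key u).2.2.2.ne'
      have est : ∀ (u : (ball x η ∩ closedBall 0 1 : Set E)) (y z : E), ‖y‖ ≤ 1 →
          ‖y - z‖ < ε / 2 → ‖((‖(u : E)‖ : ℝ) : 𝕜) • y‖ ≤ 1 ∧
            ‖((‖(u : E)‖ : ℝ) : 𝕜) • y - z‖ < ε := by
        intro u y z hy hyz
        obtain ⟨k1, k2, k3, k4⟩ := key u
        constructor
        · rw [norm_smul, RCLike.norm_ofReal, abs_norm]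
          exact mul_le_one₀ k2 (norm_nonneg _) hy
        · have e1 : y - ((‖(u : E)‖ : ℝ) : 𝕜) • y = ((1 - ‖(u : E)‖ : ℝ) : 𝕜) • y := by
            rw [RCLike.ofReal_sub, RCLike.ofReal_one, sub_smul, one_smul]
          have e2 : ‖((‖(u : E)‖ : ℝ) : 𝕜) • y - y‖ ≤ 1 - ‖(u : E)‖ := by
            rw [norm_sub_rev, e1, norm_smul, RCLike.norm_ofReal, abs_of_nonneg (by linarith)]
            exact mul_le_of_le_one_right (by linarith) hy
          have e3 := norm_sub_le_norm_sub_add_norm_sub (((‖(u : E)‖ : ℝ) : 𝕜) • y) y z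
          linarith
      refine ⟨η, hη, ![fun u => ((‖(u : E)‖ : ℝ) : 𝕜) • v₁ (w u),
        fun u => ((‖(u : E)‖ : ℝ) : 𝕜) • v₂ (w u)], ?_, ?_⟩
      · intro j
        fin_cases j
        · exact hcn.smul (hc1.comp hw)
        · exact hcn.smul (hc2.comp hw)
      · intro u
        obtain ⟨p1, p2, p3, p4, p5⟩ := hv (w u)
        have q1 := est u _ _ p1 p4
        have q2 := est u _ _ p2 p5
        refine ⟨?_, ?_, ?_⟩
        · intro j
          fin_cases j
          · exact q1.1
          · exact q2.1
        · have hc0 : ((‖(u : E)‖ : ℝ) : 𝕜) ≠ 0 := by exact_mod_cast (key u).2.2.2.ne'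
          have e : (u : E) = ((‖(u : E)‖ : ℝ) : 𝕜) • (w u : E) := (smul_inv_smul₀ hc0 _).symm
          rw [Fin.sum_univ_two]
          change (u : E) = ((lam 0 : ℝ) : 𝕜) • (((‖(u : E)‖ : ℝ) : 𝕜) • v₁ (w u)) +
            ((lam 1 : ℝ) : 𝕜) • (((‖(u : E)‖ : ℝ) : 𝕜) • v₂ (w u))
          rw [smul_comm ((lam 0 : ℝ) : 𝕜), smul_comm ((lam 1 : ℝ) : 𝕜), ← smul_add, ← p3]
          exact e
        · intro j
          fin_cases j
          · exact q1.2
          · exact q2.2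
end

section
/- Every two dimensional real Banach space has property (co). -/
open Metric Topology

lemma ker_prop {E : Type*} [NormedAddCommGroup E] [NormedSpace ℝ E]
    (h : Module.finrank ℝ E = 2) (f : E →L[ℝ] ℝ) (x : E) (hx : f x = 1)
    (d z : E) (hd : f d = 0) (hd0 : d ≠ 0) (hz : f z = 0) : ∃ s : ℝ, s • d = z := by
  have : FiniteDimensional ℝ E := Module.finite_of_finrank_pos (by omega)
  have hf : (f : E →ₗ[ℝ] ℝ) ≠ 0 := by
    intro h0
    have := congrArg (fun g : E →ₗ[ℝ] ℝ => g x) h0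
    simp [hx] at this
  have h1 := Module.Dual.finrank_ker_add_one_of_ne_zero (f := (f : E →ₗ[ℝ] ℝ)) hf
  have h2 : Module.finrank ℝ (LinearMap.ker (f : E →ₗ[ℝ] ℝ)) = 1 := by omega
  have hdn : (⟨d, by simpa using hd⟩ : LinearMap.ker (f : E →ₗ[ℝ] ℝ)) ≠ 0 := by
    intro h0
    exact hd0 (congrArg Subtype.val h0)
  obtain ⟨s, hs⟩ := (finrank_eq_one_iff_of_nonzero' _ hdn).1 h2 ⟨z, by simpa using hz⟩
  exact ⟨s, congrArg Subtype.val hs⟩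

lemma sum_prop {E : Type*} [NormedAddCommGroup E] [NormedSpace ℝ E] {n : ℕ}
    (xs : Fin n → E) (lam : Fin n → ℝ) (x u : E) (c : ℝ) (hsum : (∑ j, lam j) = 1)
    (hx : x = ∑ j, lam j • xs j) : u = ∑ j, lam j • (u + c • (xs j - x)) := by
  have h1 : ∑ j, lam j • (u + c • (xs j - x))
      = (∑ j, lam j) • u + c • ((∑ j, lam j • xs j) - (∑ j, lam j) • x) := by
    rw [Finset.sum_smul, Finset.sum_smul, ← Finset.sum_sub_distrib, Finset.smul_sum,
      ← Finset.sum_add_distrib]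
    refine Finset.sum_congr rfl fun j _ => ?_
    module
  rw [h1, hsum, ← hx]; simp

lemma seg_prop {E : Type*} [NormedAddCommGroup E] [NormedSpace ℝ E] {n : ℕ}
    (h : Module.finrank ℝ E = 2)
    (xs : Fin n → E) (lam : Fin n → ℝ) (x : E) (hxs : ∀ j, ‖xs j‖ ≤ 1) (hl : ∀ j, 0 < lam j)
    (hsum : (∑ j, lam j) = 1) (hx : x = ∑ j, lam j • xs j) (hx1 : ‖x‖ ≤ 1)
    (f : E →L[ℝ] ℝ) (hfx : f x = 1) (hfj : ∀ j, f (xs j) = 1) (k : Fin n) (hk : xs k ≠ x) :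
    ∃ ρ : ℝ, 0 < ρ ∧ ∀ z, f z = 0 → ‖z‖ ≤ ρ → ‖x + z‖ ≤ 1 := by
  have hd0 : xs k - x ≠ 0 := sub_ne_zero.2 hk
  have hn : 0 < ‖xs k - x‖ := norm_pos_iff.2 hd0
  have hlk1 : lam k ≤ 1 := by
    rw [← hsum]; exact Finset.single_le_sum (fun j _ => (hl j).le) (Finset.mem_univ k)
  refine ⟨lam k * ‖xs k - x‖, mul_pos (hl k) hn, fun z hz hzn => ?_⟩
  obtain ⟨s, rfl⟩ := ker_prop h f x hfx (xs k - x) z (by simp [hfx, hfj]) hd0 hz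
  rw [norm_smul, Real.norm_eq_abs] at hzn
  have hs : |s| ≤ lam k := le_of_mul_le_mul_right hzn hn
  obtain ⟨hs1, hs2⟩ := abs_le.1 hs
  have hconv : ∀ (a b : E) (p q : ℝ), 0 ≤ p → 0 ≤ q → p + q = 1 → ‖a‖ ≤ 1 → ‖b‖ ≤ 1 →
      ‖p • a + q • b‖ ≤ 1 := by
    intro a b p q hp hq hpq ha hb
    have := convex_closedBall (0 : E) 1 (by simpa using ha) (by simpa using hb) hp hq hpq
    simpa using this
  have hy : ‖x - lam k • (xs k - x)‖ ≤ 1 := by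
    have h1 : x - lam k • (xs k - x)
        = lam k • x + ∑ j ∈ Finset.univ.erase k, lam j • xs j := by
      have := Finset.add_sum_erase Finset.univ (fun j => lam j • xs j) (Finset.mem_univ k)
      rw [← hx] at this
      have h2 : ∑ j ∈ Finset.univ.erase k, lam j • xs j = x - lam k • xs k := by
        rw [← this]; simp
      rw [h2]; module
    have h3 : ‖∑ j ∈ Finset.univ.erase k, lam j • xs j‖ ≤ 1 - lam k := by
      have := Finset.add_sum_erase Finset.univ lam (Finset.mem_univ k)
      rw [hsum] at this
      have h4 : 1 - lam k = ∑ j ∈ Finset.univ.erase k, lam j := by linarith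
      rw [h4]
      refine norm_sum_le_of_le _ fun j _ => ?_
      rw [norm_smul, Real.norm_eq_abs, abs_of_pos (hl j)]
      exact mul_le_of_le_one_right (hl j).le (hxs j)
    rw [h1]
    refine (norm_add_le _ _).trans ?_
    rw [norm_smul, Real.norm_eq_abs, abs_of_pos (hl k)]
    have := mul_le_of_le_one_right (hl k).le hx1
    linarith
  rcases le_total 0 s with h0 | h0
  · have := hconv (xs k) x s (1 - s) h0 (by linarith) (by ring) (hxs k) hx1
    convert this using 2; module
  · have hlk := (hl k).ne'
    have := hconv (x - lam k • (xs k - x)) x (-s / lam k) (1 - -s / lam k)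
      (div_nonneg (by linarith) (hl k).le)
      (by rw [sub_nonneg, div_le_one (hl k)]; linarith) (by ring) hy hx1
    convert this using 2
    have e : s = -((-s / lam k) * lam k) := by field_simp
    generalize -s / lam k = r at *
    rw [e]; module

/-- Every two dimensional real Banach space has property (co). -/
theorem stmt14 {E : Type*} [NormedAddCommGroup E] [NormedSpace ℝ E]
    (h : Module.finrank ℝ E = 2) :
    PropCo ℝ E := by
  intro x hx1 n _ xs lam hxs hl hsum hx ε hε
  simp only [RCLike.ofReal_real_eq_id, id] at hx ⊢
  by_cases hall : ∀ j, xs j = x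
  · refine ⟨ε, hε, fun _ u => u, fun _ => continuous_subtype_val, fun u => ⟨fun _ => ?_, ?_, ?_⟩⟩
    · simpa using u.2.2
    · rw [← Finset.sum_smul, hsum, one_smul]
    · intro j
      rw [hall j]
      simpa [dist_eq_norm] using u.2.1
  push Not at hall
  obtain ⟨k, hk⟩ := hall
  have hdj : ∀ j, ‖xs j - x‖ ≤ 2 := fun j => by
    have := norm_sub_le (xs j) x
    have := hxs j
    linarith
  rcases lt_or_eq_of_le hx1 with hlt | heq
  · obtain ⟨t, ht0, ht1, ht2⟩ : ∃ t : ℝ, 0 < t ∧ t ≤ 1 / 2 ∧ t ≤ ε / 8 :=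
      ⟨min (1 / 2) (ε / 8), by positivity, min_le_left _ _, min_le_right _ _⟩
    have hp : 0 < t * (1 - ‖x‖) := mul_pos ht0 (by linarith)
    refine ⟨min (t * (1 - ‖x‖)) (ε / 8), by positivity, fun j u => u + (1 - t) • (xs j - x),
      fun j => by fun_prop, fun u => ⟨fun j => ?_, sum_prop xs lam x u _ hsum hx, fun j => ?_⟩⟩
    all_goals
      beta_reduce
      have hu1 : ‖(u : E) - x‖ < min (t * (1 - ‖x‖)) (ε / 8) := by
        simpa [dist_eq_norm] using u.2.1
      obtain ⟨ha, hb⟩ := lt_min_iff.1 hu1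
    · have e : (u : E) + (1 - t) • (xs j - x) = (u - x) + ((1 - t) • xs j + t • x) := by module
      rw [e]
      have h1 := norm_add_le ((u : E) - x) ((1 - t) • xs j + t • x)
      have h2 := norm_add_le ((1 - t) • xs j) (t • x)
      rw [norm_smul, norm_smul, Real.norm_eq_abs, Real.norm_eq_abs, abs_of_pos ht0,
        abs_of_pos (by linarith : (0 : ℝ) < 1 - t)] at h2
      have h3 := mul_le_of_le_one_right (by linarith : (0 : ℝ) ≤ 1 - t) (hxs j)
      linarith
    · have e : (u : E) + (1 - t) • (xs j - x) - xs j = (u - x) - t • (xs j - x) := by module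
      rw [e]
      have h1 := norm_sub_le ((u : E) - x) (t • (xs j - x))
      rw [norm_smul, Real.norm_eq_abs, abs_of_pos ht0] at h1
      have h3 := mul_le_mul_of_nonneg_left (hdj j) ht0.le
      linarith
  · obtain ⟨f, hf1, hfx⟩ := exists_dual_vector ℝ x (by intro h0; simp [h0] at heq)
    have hfx : f x = 1 := by simpa [heq] using hfx
    have hfle : ∀ y : E, |f y| ≤ ‖y‖ := fun y => by simpa [hf1] using f.le_opNorm y
    have hfj : ∀ j, f (xs j) = 1 := by
      have h1 : ∑ j, lam j * (1 - f (xs j)) = 0 := by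
        have h2 : ∑ j, lam j * f (xs j) = 1 := by
          have := congrArg f hx
          rw [hfx, map_sum] at this
          simpa using this.symm
        simp only [mul_sub, mul_one, Finset.sum_sub_distrib, hsum, h2, sub_self]
      have hn : ∀ j, 0 ≤ 1 - f (xs j) := fun j => by
        have := (le_abs_self _).trans ((hfle (xs j)).trans (hxs j))
        linarith
      intro j
      have := (Finset.sum_eq_zero_iff_of_nonneg
        (fun j _ => mul_nonneg (hl j).le (hn j))).1 h1 j (Finset.mem_univ j)
      have := (mul_eq_zero.1 this).resolve_left (hl j).ne'
      linarith
    obtain ⟨ρ, hρ, hρz⟩ := seg_prop h xs lam x hxs hl hsum hx hx1 f hfx hfj k hk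
    obtain ⟨t, ht0, ht1, ht2⟩ : ∃ t : ℝ, 0 < t ∧ t ≤ 1 / 2 ∧ t ≤ ε / 8 :=
      ⟨min (1 / 2) (ε / 8), by positivity, min_le_left _ _, min_le_right _ _⟩
    obtain ⟨δ, hδ0, hδ1, hδ2, hδ3⟩ : ∃ δ : ℝ, 0 < δ ∧ δ ≤ 1 / 2 ∧ δ ≤ ε / 8 ∧ δ ≤ t * ρ / 4 :=
      ⟨min (1 / 2) (min (ε / 8) (t * ρ / 4)), by positivity, min_le_left _ _,
        (min_le_right _ _).trans (min_le_left _ _), (min_le_right _ _).trans (min_le_right _ _)⟩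
    refine ⟨δ, hδ0, fun j u => u + (f u * (1 - t)) • (xs j - x),
      fun j => by fun_prop, fun u => ⟨fun j => ?_, sum_prop xs lam x u _ hsum hx, fun j => ?_⟩⟩
    all_goals
      beta_reduce
      have hu1 : ‖(u : E) - x‖ < δ := by simpa [dist_eq_norm] using u.2.1
      have hu2 : ‖(u : E)‖ ≤ 1 := by simpa using u.2.2
      have hfu := hfle (u - x)
      rw [map_sub, hfx] at hfu
      obtain ⟨hfa, hfb⟩ := abs_le.1 hfu
      have hfu1 : f u ≤ 1 := (le_abs_self _).trans ((hfle u).trans hu2)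
      have hfu0 : 1 / 2 < f u := by linarith
      generalize (u : E) = w at *
      have hw0 : f w ≠ 0 := by linarith
    · have hz0 : f (t⁻¹ • ((f w)⁻¹ • w - x)) = 0 := by simp [hfx, hw0]
      have hz1 : ‖t⁻¹ • ((f w)⁻¹ • w - x)‖ ≤ ρ := by
        have e : t⁻¹ • ((f w)⁻¹ • w - x) = (t * f w)⁻¹ • ((w - x) - (f w - 1) • x) := by
          have : x = (f w)⁻¹ • f w • x := by rw [smul_smul, inv_mul_cancel₀ hw0, one_smul]
          rw [mul_inv, mul_smul]
          congr 1
          conv_lhs => rw [this]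
          module
        have hp : 0 < t * f w := mul_pos ht0 (by linarith)
        rw [e, norm_smul, norm_inv, Real.norm_eq_abs, abs_of_pos hp, inv_mul_le_iff₀ hp]
        have h1 := norm_sub_le (w - x) ((f w - 1) • x)
        rw [norm_smul, heq, Real.norm_eq_abs] at h1
        have : t * ρ * (1 / 2) ≤ t * ρ * f w :=
          mul_le_mul_of_nonneg_left hfu0.le (by positivity)
        nlinarith
      have hz := hρz _ hz0 hz1
      have e : w + (f w * (1 - t)) • (xs j - x)
          = f w • ((1 - t) • xs j + t • (x + t⁻¹ • ((f w)⁻¹ • w - x))) := by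
        have e1 : t • (x + t⁻¹ • ((f w)⁻¹ • w - x)) = t • x + ((f w)⁻¹ • w - x) := by
          rw [smul_add, smul_smul, mul_inv_cancel₀ ht0.ne', one_smul]
        rw [e1]
        have e2 : f w • (f w)⁻¹ • w = w := by rw [smul_smul, mul_inv_cancel₀ hw0, one_smul]
        rw [smul_add, smul_add, smul_sub (f w) ((f w)⁻¹ • w) x, e2]
        module
      have hc : ‖(1 - t) • xs j + t • (x + t⁻¹ • ((f w)⁻¹ • w - x))‖ ≤ 1 := by
        have := convex_closedBall (0 : E) 1 (by simpa using hxs j) (by simpa using hz)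
          (by linarith : (0 : ℝ) ≤ 1 - t) ht0.le (by ring)
        simpa using this
      rw [e, norm_smul, Real.norm_eq_abs, abs_of_pos (by linarith)]
      exact mul_le_one₀ hfu1 (norm_nonneg _) hc
    · have e : w + (f w * (1 - t)) • (xs j - x) - xs j
          = (w - x) - (1 - f w * (1 - t)) • (xs j - x) := by module
      rw [e]
      have h1 := norm_sub_le (w - x) ((1 - f w * (1 - t)) • (xs j - x))
      have h4 : 0 ≤ 1 - f w * (1 - t) := by nlinarith
      have h5 : 1 - f w * (1 - t) ≤ δ + t := by nlinarith
      rw [norm_smul, Real.norm_eq_abs, abs_of_nonneg h4] at h1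
      have h3 := mul_le_mul h5 (hdj j) (norm_nonneg _) (by linarith)
      linarith
end

section
/- For every n ∈ ℕ, the complex space ℓ_1^n (i.e., ℂ^n equipped with the norm ‖(z_1,…,z_n)‖ = Σ_{i=1}^n |z_i|) has property (co). -/
open Metric Topology

lemma co_of_eventually {E : Type*} [NormedAddCommGroup E] [NormedSpace ℂ E] {m : ℕ}
    (x : E) (xs : Fin m → E) (lam : Fin m → ℝ) (ε : ℝ) (V : Fin m → E → E)
    (hc : ∀ᶠ u in 𝓝 x, ∀ j, ContinuousAt (V j) u)
    (hn : ∀ᶠ u in 𝓝 x, ‖u‖ ≤ 1 → ∀ j, ‖V j u‖ ≤ 1)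
    (hs : ∀ᶠ u in 𝓝 x, u = (∑ j, ((lam j : ℝ) : ℂ) • V j u))
    (hx : ∀ j, ‖V j x - xs j‖ < ε) :
    ∃ δ : ℝ, 0 < δ ∧
      ∃ v : Fin m → ((ball x δ ∩ closedBall 0 1 : Set E) → E),
        (∀ j, Continuous (v j)) ∧
        ∀ u : (ball x δ ∩ closedBall 0 1 : Set E),
          (∀ j, ‖v j u‖ ≤ 1) ∧
          (u : E) = (∑ j, ((lam j : ℝ) : ℂ) • v j u) ∧
          ∀ j, ‖v j u - xs j‖ < ε := by
  have hd : ∀ᶠ u in 𝓝 x, ∀ j, ‖V j u - xs j‖ < ε := by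
    rw [Filter.eventually_all]
    intro j
    have h1 : ContinuousAt (fun u => ‖V j u - xs j‖) x :=
      ((hc.self_of_nhds j).sub continuousAt_const).norm
    exact h1.eventually_lt continuousAt_const (hx j)
  obtain ⟨δ, hδ, h⟩ := Metric.eventually_nhds_iff_ball.1 (hc.and (hn.and (hs.and hd)))
  refine ⟨δ, hδ, fun j u => V j u, ?_, ?_⟩
  · intro j
    rw [continuous_iff_continuousAt]
    intro u
    exact ContinuousAt.comp (f := Subtype.val) ((h u u.2.1).1 j) continuous_subtype_val.continuousAt
  · intro u
    obtain ⟨_, h2, h3, h4⟩ := h u u.2.1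
    exact ⟨h2 (by simpa using u.2.2), h3, h4⟩

lemma co_interior {E : Type*} [NormedAddCommGroup E] [NormedSpace ℂ E] {m : ℕ}
    (x : E) (hx1 : ‖x‖ < 1) : HasCoN ℂ m x := by
  intro xs lam hxs hlam hsum hx ε hε
  obtain ⟨t, ht0, ht1, ht⟩ : ∃ t : ℝ, 0 < t ∧ t < 1 ∧ 2 * t < ε :=
    ⟨min (1/2) (ε/4), by positivity, by
      have := min_le_left (1/2:ℝ) (ε/4); linarith, by
      have := min_le_right (1/2:ℝ) (ε/4); linarith⟩
  have hsumC : (∑ j, (lam j : ℂ)) = 1 := by exact_mod_cast hsum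
  refine co_of_eventually x xs lam ε (fun j u => ((1 - t : ℝ) : ℂ) • xs j + ((t : ℝ) : ℂ) • x + (u - x))
    ?_ ?_ ?_ ?_
  · refine Filter.Eventually.of_forall fun u j => ?_
    fun_prop
  · have : ∀ᶠ u in 𝓝 x, ‖u - x‖ < t * (1 - ‖x‖) := by
      have h0 : 0 < t * (1 - ‖x‖) := by
        apply mul_pos ht0; linarith
      filter_upwards [Metric.ball_mem_nhds x h0] with u hu
      simpa [dist_eq_norm] using hu
    filter_upwards [this] with u hu _ j
    have a1 : ‖((1 - t : ℝ) : ℂ) • xs j‖ ≤ 1 - t := by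
      rw [norm_smul, Complex.norm_real, Real.norm_of_nonneg (by linarith)]
      exact mul_le_of_le_one_right (by linarith) (hxs j)
    have a2 : ‖((t : ℝ) : ℂ) • x‖ = t * ‖x‖ := by
      rw [norm_smul, Complex.norm_real, Real.norm_of_nonneg ht0.le]
    refine (norm_add₃_le).trans ?_
    nlinarith
  · refine Filter.Eventually.of_forall fun u => ?_
    have e : ∀ j, (lam j : ℂ) • (((1 - t : ℝ) : ℂ) • xs j + ((t : ℝ) : ℂ) • x + (u - x))
      = ((1 - t : ℝ) : ℂ) • ((lam j : ℂ) • xs j) + (lam j : ℂ) • (((t : ℝ) : ℂ) • x + (u - x)) := by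
      intro j; module
    simp only [e]
    rw [Finset.sum_add_distrib, ← Finset.smul_sum, ← Finset.sum_smul, hsumC]
    change _ = _ • (∑ j, ((lam j : ℝ) : ℂ) • xs j) + _
    erw [← hx]
    push_cast
    module
  · intro j
    have : ((1 - t : ℝ) : ℂ) • xs j + ((t : ℝ) : ℂ) • x + (x - x) - xs j = ((t : ℝ) : ℂ) • (x - xs j) := by
      push_cast; module
    rw [this, norm_smul, Complex.norm_real, Real.norm_of_nonneg ht0.le]
    have := norm_sub_le x (xs j)
    have := hxs j
    nlinarith

lemma co_boundary {n m : ℕ} (x : PiLp 1 (fun _ : Fin n => ℂ)) (hx1 : ‖x‖ = 1) :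
    HasCoN ℂ m x := by
  intro xs lam hxs hlam hsum hx ε hε
  obtain ⟨t, ht0, ht1, ht⟩ : ∃ t : ℝ, 0 < t ∧ t < 1 ∧ 2 * t < ε :=
    ⟨min (1/2) (ε/4), by positivity, by
      have := min_le_left (1/2:ℝ) (ε/4); linarith, by
      have := min_le_right (1/2:ℝ) (ε/4); linarith⟩
  have hN : ∀ y : PiLp 1 (fun _ : Fin n => ℂ), ‖y‖ = ∑ i, ‖y i‖ := by
    intro y
    simpa using PiLp.norm_eq_of_nat (p := 1) 1 (by simp) y
  have hxi : ∀ i, x i = ∑ j, (lam j : ℂ) * xs j i := by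
    intro i
    have := congrArg (fun y : PiLp 1 (fun _ : Fin n => ℂ) => y i) hx
    simpa using this
  have hle : ∀ i, ‖x i‖ ≤ ∑ j, lam j * ‖xs j i‖ := by
    intro i
    rw [hxi i]
    refine (norm_sum_le _ _).trans (le_of_eq ?_)
    refine Finset.sum_congr rfl fun j _ => ?_
    rw [norm_mul, Complex.norm_real, Real.norm_of_nonneg (hlam j).le]
  have hnorm : ∀ i, ‖x i‖ = ∑ j, lam j * ‖xs j i‖ := by
    have h1 : ∑ i, ∑ j, lam j * ‖xs j i‖ ≤ ∑ i, ‖x i‖ := by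
      rw [← hN x, hx1, Finset.sum_comm, ← hsum]
      refine Finset.sum_le_sum fun j _ => ?_
      rw [← Finset.mul_sum, ← hN]
      exact mul_le_of_le_one_right (hlam j).le (hxs j)
    have h2 := le_antisymm (Finset.sum_le_sum fun i _ => hle i) h1
    have := (Finset.sum_eq_sum_iff_of_le fun i _ => hle i).1 h2
    exact fun i => this i (Finset.mem_univ i)
  have hzero : ∀ i j, x i = 0 → xs j i = 0 := by
    intro i j h
    have h1 := hnorm i
    rw [h, norm_zero, eq_comm, Finset.sum_eq_zero_iff_of_nonneg
      (fun j _ => mul_nonneg (hlam j).le (norm_nonneg _))] at h1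
    have := h1 j (Finset.mem_univ j)
    simpa [(hlam j).ne'] using this
  have hphase : ∀ i j, ‖xs j i‖ • x i = ‖x i‖ • xs j i := by
    intro i
    have hle2 : ∀ j ∈ Finset.univ, lam j * inner ℝ (x i) (xs j i) ≤ lam j * (‖x i‖ * ‖xs j i‖) :=
      fun j _ => mul_le_mul_of_nonneg_left (real_inner_le_norm _ _) (hlam j).le
    have heq : ∑ j, lam j * inner ℝ (x i) (xs j i) = ∑ j, lam j * (‖x i‖ * ‖xs j i‖) := by
      have e1 : ∑ j, lam j * inner ℝ (x i) (xs j i) = inner ℝ (x i) (x i) := by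
        conv_rhs => rw [hxi i]
        conv_lhs => rw [hxi i]
        rw [inner_sum]
        refine Finset.sum_congr rfl fun j _ => ?_
        rw [← Complex.real_smul, real_inner_smul_right]
      rw [e1, real_inner_self_eq_norm_mul_norm]
      conv_lhs => rw [hnorm i]
      rw [← hnorm i]
      nth_rw 2 [hnorm i]
      rw [Finset.mul_sum]
      exact Finset.sum_congr rfl fun j _ => by ring
    intro j
    have h3 := (Finset.sum_eq_sum_iff_of_le hle2).1 heq j (Finset.mem_univ j)
    have h4 := mul_left_cancel₀ (hlam j).ne' h3
    exact inner_eq_norm_mul_iff_real.1 h4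
  have hci : ∀ i, Continuous fun u : PiLp 1 (fun _ : Fin n => ℂ) => u i := fun i => by fun_prop
  have hnear : ∀ᶠ u in 𝓝 x, ∀ i, x i ≠ 0 → u i ≠ 0 ∧ (1 - t) * ‖x i‖ < ‖u i‖ := by
    rw [Filter.eventually_all]
    intro i
    by_cases h : x i = 0
    · exact Filter.Eventually.of_forall fun u h' => (h' h).elim
    · have h0 : 0 < ‖x i‖ := norm_pos_iff.2 h
      have h1 : ∀ᶠ u in 𝓝 x, (1 - t) * ‖x i‖ < ‖u i‖ :=
        continuousAt_const.eventually_lt (hci i).norm.continuousAt (by nlinarith)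
      filter_upwards [h1] with u hu _
      refine ⟨norm_pos_iff.1 (lt_of_le_of_lt ?_ hu), hu⟩
      exact mul_nonneg (by linarith) h0.le
  refine co_of_eventually x xs lam ε (fun j u => WithLp.toLp 1 fun i =>
      u i + (((1 - t) * (‖xs j i‖ - ‖x i‖) / ‖u i‖ : ℝ) : ℂ) * u i) ?_ ?_ ?_ ?_
  · filter_upwards [hnear] with u hu j
    refine (PiLp.continuous_toLp 1 _).continuousAt.comp ?_
    rw [continuousAt_pi]
    intro i
    by_cases h : x i = 0
    · simp only [h, hzero i j h, sub_self, norm_zero, mul_zero, zero_div, Complex.ofReal_zero,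
        zero_mul, add_zero]
      exact (hci i).continuousAt
    · refine (hci i).continuousAt.add (ContinuousAt.mul ?_ (hci i).continuousAt)
      refine Complex.continuous_ofReal.continuousAt.comp ?_
      exact continuousAt_const.div (hci i).norm.continuousAt (norm_ne_zero_iff.2 (hu i h).1)
  · filter_upwards [hnear] with u hu hu1 j
    have key : ∀ i, ‖u i + (((1 - t) * (‖xs j i‖ - ‖x i‖) / ‖u i‖ : ℝ) : ℂ) * u i‖
        = ‖u i‖ + (1 - t) * ‖xs j i‖ - (1 - t) * ‖x i‖ := by
      intro i
      by_cases h : x i = 0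
      · simp [h, hzero i j h]
      · obtain ⟨h1, h2⟩ := hu i h
        have h3 : 0 < ‖u i‖ := norm_pos_iff.2 h1
        have e : u i + (((1 - t) * (‖xs j i‖ - ‖x i‖) / ‖u i‖ : ℝ) : ℂ) * u i
          = ((1 + (1 - t) * (‖xs j i‖ - ‖x i‖) / ‖u i‖ : ℝ) : ℂ) * u i := by
          push_cast; ring
        have e2 : (1 + (1 - t) * (‖xs j i‖ - ‖x i‖) / ‖u i‖)
          = (‖u i‖ + (1 - t) * ‖xs j i‖ - (1 - t) * ‖x i‖) / ‖u i‖ := by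
          field_simp; ring
        have h4 : 0 ≤ (1 - t) * ‖xs j i‖ := mul_nonneg (by linarith) (norm_nonneg _)
        rw [e, e2, norm_mul, Complex.norm_real, Real.norm_of_nonneg]
        · field_simp
        · apply div_nonneg _ h3.le
          linarith
    rw [hN]
    simp only [key]
    rw [Finset.sum_sub_distrib, Finset.sum_add_distrib, ← Finset.mul_sum, ← Finset.mul_sum,
      ← hN, ← hN, ← hN, hx1]
    have := hxs j
    nlinarith
  · refine Filter.Eventually.of_forall fun u => ?_
    ext i
    have e : (∑ j, (lam j : ℂ) * (u i + (((1 - t) * (‖xs j i‖ - ‖x i‖) / ‖u i‖ : ℝ) : ℂ) * u i))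
        = ((∑ j, lam j * (1 + (1 - t) * (‖xs j i‖ - ‖x i‖) / ‖u i‖) : ℝ) : ℂ) * u i := by
      push_cast
      rw [Finset.sum_mul]
      exact Finset.sum_congr rfl fun j _ => by ring
    have e2 : ∑ j, lam j * (1 + (1 - t) * (‖xs j i‖ - ‖x i‖) / ‖u i‖) = 1 := by
      have : ∀ j, lam j * (1 + (1 - t) * (‖xs j i‖ - ‖x i‖) / ‖u i‖)
        = lam j * (1 - (1 - t) * ‖x i‖ / ‖u i‖) + lam j * ‖xs j i‖ * ((1 - t) / ‖u i‖) := by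
        intro j; ring
      simp only [this]
      rw [Finset.sum_add_distrib, ← Finset.sum_mul, ← Finset.sum_mul, hsum, ← hnorm i]
      ring
    rw [e2, Complex.ofReal_one, one_mul] at e
    simpa [mul_add] using e.symm
  · intro j
    have : (WithLp.toLp 1 (fun i =>
      x i + (((1 - t) * (‖xs j i‖ - ‖x i‖) / ‖x i‖ : ℝ) : ℂ) * x i) :
        PiLp 1 (fun _ : Fin n => ℂ)) - xs j = ((t : ℝ) : ℂ) • (x - xs j) := by
      ext i
      simp only [PiLp.sub_apply, PiLp.smul_apply, smul_eq_mul]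
      by_cases h : x i = 0
      · simp [h, hzero i j h]
      · have h5 := hphase i j
        rw [Complex.real_smul, Complex.real_smul] at h5
        have h6 : (‖x i‖ : ℂ) ≠ 0 := by simpa using h
        push_cast
        field_simp
        linear_combination (1 - (t : ℂ)) * h5
    rw [this, norm_smul, Complex.norm_real, Real.norm_of_nonneg ht0.le]
    have := norm_sub_le x (xs j)
    have := hxs j
    nlinarith

/-- For every `n`, the complex space `ℓ₁ⁿ` (that is, `ℂⁿ` with the norm
`‖z‖ = ∑ i, |z i|`) has property (co). -/
theorem stmt15 (n : ℕ) :
    PropCo ℂ (PiLp 1 (fun _ : Fin n => ℂ)) := by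
  intro x hx m _
  rcases hx.lt_or_eq with h | h
  · exact co_interior x h
  · exact co_boundary x h
end

section
/- Let X be a Banach space, let n ∈ ℕ, let U_1,…,U_n be relatively weakly open subsets of B_X, and let λ_1,…,λ_n > 0 with Σ_{j=1}^n λ_j = 1. Then every x ∈ Σ_{j=1}^n λ_j U_j with ‖x‖ < 1 can be written as x = Σ_{j=1}^n λ_j x_j where x_j ∈ U_j and ‖x_j‖ < 1 for every j ∈ {1,…,n}. -/
open Metric Topology

/-- Every point of norm `< 1` of a finite convex combination of relatively
weakly open subsets of `B_X` can be written as the corresponding convex combination of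
points of the `U_j` of norm `< 1`. -/
theorem stmt16 {𝕜 E : Type*} [RCLike 𝕜] [NormedAddCommGroup E] [NormedSpace 𝕜 E]
    [CompleteSpace E] (n : ℕ) (U : Fin n → Set E) (lam : Fin n → ℝ)
    (hU : ∀ j, RelWeakOpen 𝕜 (U j)) (hlam : ∀ j, 0 < lam j) (hsum : (∑ j, lam j) = 1)
    (x : E) (hx : x ∈ ConvComb 𝕜 lam U) (hxnorm : ‖x‖ < 1) :
    ∃ xs : Fin n → E, (∀ j, xs j ∈ U j) ∧ (∀ j, ‖xs j‖ < 1) ∧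
      x = ∑ j, ((lam j : ℝ) : 𝕜) • xs j := by
  obtain ⟨u, hu, rfl⟩ := hx
  set x : E := ∑ j, ((lam j : ℝ) : 𝕜) • u j with hxdef
  have hev : ∀ j, ∀ᶠ s : ℝ in 𝓝[>] 0, u j + ((s : ℝ) : 𝕜) • (x - u j) ∈ (hU j).2.choose := by
    intro j
    obtain ⟨hVo, hVe⟩ := (hU j).2.choose_spec
    obtain ⟨W, hW, hWV⟩ := isOpen_induced_iff.mp hVo
    have hcont : Continuous (fun (y : E) (f : E →L[𝕜] 𝕜) => f y) :=
      continuous_pi fun f => f.continuous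
    have hVopen : IsOpen (hU j).2.choose := by
      rw [← hWV]; exact hW.preimage hcont
    have hc : Continuous (fun s : ℝ => u j + ((s : ℝ) : 𝕜) • (x - u j)) :=
      continuous_const.add ((RCLike.continuous_ofReal).smul continuous_const)
    have hm : u j ∈ (hU j).2.choose := by
      have h := hu j
      rw [hVe] at h
      exact h.1
    have := (hVopen.preimage hc).mem_nhds (x := (0 : ℝ)) (by simpa using hm)
    exact mem_nhdsWithin_of_mem_nhds this
  have hlt : ∀ᶠ s : ℝ in 𝓝[>] 0, s ∈ Set.Ioo (0 : ℝ) 1 := Ioo_mem_nhdsGT one_pos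
  obtain ⟨s, hs, hs0, hs1⟩ := ((Filter.eventually_all.mpr hev).and hlt).exists
  have hnorm : ∀ j, ‖u j + ((s : ℝ) : 𝕜) • (x - u j)‖ < 1 := by
    intro j
    have huj : ‖u j‖ ≤ 1 := by simpa using (hU j).1 (hu j)
    have he : u j + ((s : ℝ) : 𝕜) • (x - u j)
        = ((1 - s : ℝ) : 𝕜) • u j + ((s : ℝ) : 𝕜) • x := by
      push_cast
      module
    rw [he]
    calc _ ≤ ‖((1 - s : ℝ) : 𝕜) • u j‖ + ‖((s : ℝ) : 𝕜) • x‖ := norm_add_le _ _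
      _ = (1 - s) * ‖u j‖ + s * ‖x‖ := by
        rw [norm_smul, norm_smul, RCLike.norm_ofReal, RCLike.norm_ofReal,
          abs_of_pos hs0, abs_of_pos (sub_pos.mpr hs1)]
      _ < 1 := by nlinarith
  refine ⟨fun j => u j + ((s : ℝ) : 𝕜) • (x - u j), fun j => ?_, hnorm, ?_⟩
  · have hVe := (hU j).2.choose_spec.2
    have : u j + ((s : ℝ) : 𝕜) • (x - u j) ∈ (hU j).2.choose ∩ closedBall 0 1 :=
      ⟨hs j, by simpa using (hnorm j).le⟩
    rw [← hVe] at this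
    exact this
  · have h1 : (∑ j, ((lam j : ℝ) : 𝕜)) = 1 := by
      rw [← RCLike.ofReal_sum, hsum, RCLike.ofReal_one]
    have h2 : ∑ j, ((lam j : ℝ) : 𝕜) • (x - u j) = 0 := by
      simp only [smul_sub, Finset.sum_sub_distrib]
      rw [← Finset.sum_smul, h1, one_smul, ← hxdef, sub_self]
    simp only [smul_add, Finset.sum_add_distrib]
    simp_rw [smul_comm _ ((s : ℝ) : 𝕜)]
    rw [← Finset.smul_sum, h2, smul_zero, add_zero]
end

section
/- Let X be a Banach space and let Y be a subspace of X which is the range of a norm-one linear projection P : X → X. Then Y inherits each of the properties CWO, CWO-B, and CWO-S from X; that is, if X has property CWO (respectively CWO-S, CWO-B), then so does Y. -/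
open Metric Topology

/-- Preimages of weakly open sets under bounded operators are weakly open. -/
theorem weakOpen_preimage {𝕜 E F : Type*} [NontriviallyNormedField 𝕜] [NormedAddCommGroup E]
    [NormedSpace 𝕜 E] [NormedAddCommGroup F] [NormedSpace 𝕜 F] (T : E →L[𝕜] F) {V : Set F}
    (hV : IsOpen[weakTop 𝕜 F] V) : IsOpen[weakTop 𝕜 E] (T ⁻¹' V) := by
  obtain ⟨O, hO, rfl⟩ := hV
  refine ⟨(fun (g : (E →L[𝕜] 𝕜) → 𝕜) (f : F →L[𝕜] 𝕜) => g (f.comp T)) ⁻¹' O, ?_, rfl⟩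
  exact hO.preimage (continuous_pi fun f => continuous_apply (f.comp T))

/-- Convex combinations in `Y` are traces of convex combinations in `X`. -/
theorem exists_lift {𝕜 X : Type*} [RCLike 𝕜] [NormedAddCommGroup X] [NormedSpace 𝕜 X]
    (Y : Submodule 𝕜 X) (P : X →L[𝕜] X)
    (hrange : ∀ x : X, P x ∈ Y) (hproj : ∀ y ∈ Y, P y = y) (hnorm : ‖P‖ = 1)
    {n : ℕ} (U : Fin n → Set Y) (lam : Fin n → ℝ) (hU : ∀ j, RelWeakOpen 𝕜 (U j)) :
    ∃ W : Fin n → Set X, (∀ j, RelWeakOpen 𝕜 (W j)) ∧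
      ConvComb 𝕜 lam U = Y.subtypeL ⁻¹' ConvComb 𝕜 lam W := by
  choose hsub V hV hUV using hU
  set Q : X →L[𝕜] Y := P.codRestrict Y hrange with hQ
  have hQY : ∀ y : Y, Q y = y := fun y => Subtype.ext (hproj y y.2)
  have hQn : ∀ x : X, ‖Q x‖ ≤ ‖x‖ := fun x => by
    have h := P.le_opNorm x
    rw [hnorm, one_mul] at h
    exact h
  refine ⟨fun j => Q ⁻¹' V j ∩ closedBall 0 1, fun j =>
    ⟨Set.inter_subset_right, _, weakOpen_preimage Q (hV j), rfl⟩, ?_⟩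
  ext y
  constructor
  · rintro ⟨u, hu, rfl⟩
    refine ⟨fun j => (u j : X), fun j => ?_, by simp⟩
    have h := hu j
    rw [hUV j] at h
    refine ⟨?_, ?_⟩
    · show Q (u j) ∈ V j
      rw [hQY]
      exact h.1
    · simpa using h.2
  · rintro ⟨w, hw, h⟩
    refine ⟨fun j => Q (w j), fun j => ?_, ?_⟩
    · rw [hUV j]
      refine ⟨(hw j).1, ?_⟩
      have h2 := (hw j).2
      rw [mem_closedBall_zero_iff] at h2 ⊢
      exact (hQn _).trans h2
    · have h3 := congrArg Q h
      rw [map_sum] at h3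
      simp only [map_smul] at h3
      rw [← h3]
      exact (hQY y).symm

theorem interior_lift {𝕜 X : Type*} [RCLike 𝕜] [NormedAddCommGroup X] [NormedSpace 𝕜 X]
    (Y : Submodule 𝕜 X) {C : Set X} {y : Y} (h : RelWeakInterior 𝕜 C (y : X)) :
    RelWeakInterior 𝕜 (Y.subtypeL ⁻¹' C) y := by
  obtain ⟨V, hV, hy, hVC⟩ := h
  refine ⟨_, weakOpen_preimage Y.subtypeL hV, hy, ?_⟩
  rintro z ⟨hz, hz1⟩
  exact hVC ⟨hz, by simpa using hz1⟩

/-- A subspace `Y` of `X` which is the range of a norm-one projection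
inherits each of the properties CWO, CWO-S, and CWO-B from `X`. -/
theorem stmt17 {𝕜 X : Type*} [RCLike 𝕜] [NormedAddCommGroup X] [NormedSpace 𝕜 X]
    [CompleteSpace X] (Y : Submodule 𝕜 X) (P : X →L[𝕜] X)
    (hrange : ∀ x : X, P x ∈ Y) (hproj : ∀ y ∈ Y, P y = y) (hnorm : ‖P‖ = 1) :
    (PropCWO 𝕜 X → PropCWO 𝕜 Y) ∧
    (PropCWOS 𝕜 X → PropCWOS 𝕜 Y) ∧
    (PropCWOB 𝕜 X → PropCWOB 𝕜 Y) := by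
  refine ⟨?_, ?_, ?_⟩
  · intro h n U lam hU hpos hsum
    obtain ⟨W, hW, hC⟩ := exists_lift Y P hrange hproj hnorm U lam hU
    obtain ⟨V, hV, hVC⟩ := h n W lam hW hpos hsum
    refine ⟨_, weakOpen_preimage Y.subtypeL hV, ?_⟩
    rw [hC, hVC]
    ext y
    simp
  · intro h n U lam hU hpos hsum y hy hy1
    obtain ⟨W, hW, hC⟩ := exists_lift Y P hrange hproj hnorm U lam hU
    rw [hC] at hy ⊢
    exact interior_lift Y (h n W lam hW hpos hsum y hy hy1)
  · intro h n U lam hU hpos hsum y hy hy1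
    obtain ⟨W, hW, hC⟩ := exists_lift Y P hrange hproj hnorm U lam hU
    rw [hC] at hy ⊢
    exact interior_lift Y (h n W lam hW hpos hsum y hy hy1)
end

section
/- Let {X_n}_{n∈ℕ} be a sequence of finite dimensional Banach spaces, each having property (co). Then the c_0-sum c_0(X_n) has property CWO. -/
open Metric Topology

open scoped ENNReal

/-- The `c₀`-sum of a sequence of normed spaces, realized as the subspace of `lp E ∞`
consisting of the sequences `(x_n)` with `‖x_n‖ → 0` (with the sup norm). -/
noncomputable def c0Sum (𝕜 : Type*) (E : ℕ → Type*) [RCLike 𝕜] [∀ n, NormedAddCommGroup (E n)]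
    [∀ n, NormedSpace 𝕜 (E n)] : Submodule 𝕜 (lp E ∞) where
  carrier := {f | Filter.Tendsto (fun n => ‖f n‖) Filter.atTop (nhds 0)}
  zero_mem' := by
    simp only [Set.mem_setOf_eq, lp.coeFn_zero, Pi.zero_apply, norm_zero]
    exact tendsto_const_nhds
  add_mem' := by
    intro f g hf hg
    have hle : ∀ n, ‖(↑(f + g) : ∀ n, E n) n‖ ≤ ‖f n‖ + ‖g n‖ := by
      intro n
      rw [lp.coeFn_add]
      exact norm_add_le _ _
    have h0 : Filter.Tendsto (fun n => ‖f n‖ + ‖g n‖) Filter.atTop (nhds 0) := by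
      simpa using hf.add hg
    exact squeeze_zero (fun n => norm_nonneg _) hle h0
  smul_mem' := by
    intro c f hf
    have heq : (fun n => ‖(↑(c • f) : ∀ n, E n) n‖) = fun n => ‖c‖ * ‖f n‖ := by
      funext n
      rw [lp.coeFn_smul]
      simp [norm_smul]
    show Filter.Tendsto _ _ _
    rw [heq]
    simpa using hf.const_mul ‖c‖

section C0Aux

open Filter

variable {𝕜 : Type*} [RCLike 𝕜] {E : ℕ → Type*} [∀ n, NormedAddCommGroup (E n)]
    [∀ n, NormedSpace 𝕜 (E n)]

/-- Coordinates of an element of the `c₀`-sum. -/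
def cc (x : c0Sum 𝕜 E) (n : ℕ) : E n := (x : lp E ∞) n

theorem cc_norm_le (x : c0Sum 𝕜 E) (n : ℕ) : ‖cc x n‖ ≤ ‖x‖ :=
  lp.norm_apply_le_norm (by simp) (x : lp E ∞) n

theorem norm_le_cc (x : c0Sum 𝕜 E) (C : ℝ) (h : ∀ n, ‖cc x n‖ ≤ C) : ‖x‖ ≤ C :=
  lp.norm_le_of_forall_le' (f := (x : lp E ∞)) C h

theorem cc_tendsto (x : c0Sum 𝕜 E) : Tendsto (fun n => ‖cc x n‖) atTop (𝓝 0) := x.2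

theorem cc_ext {x y : c0Sum 𝕜 E} (h : ∀ n, cc x n = cc y n) : x = y :=
  Subtype.ext (lp.ext (funext h))

theorem cc_add (x y : c0Sum 𝕜 E) (n : ℕ) : cc (x + y) n = cc x n + cc y n := rfl

theorem cc_sub (x y : c0Sum 𝕜 E) (n : ℕ) : cc (x - y) n = cc x n - cc y n := rfl

theorem cc_smul (a : 𝕜) (y : c0Sum 𝕜 E) (n : ℕ) : cc (a • y) n = a • cc y n := rfl

/-- Coordinate map as a continuous linear map. -/
noncomputable def ccL (n : ℕ) : c0Sum 𝕜 E →L[𝕜] E n :=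
  LinearMap.mkContinuous
    { toFun := fun x => cc x n
      map_add' := fun x y => cc_add x y n
      map_smul' := fun a y => cc_smul a y n } 1
    (fun x => by simpa using cc_norm_le x n)

theorem ccL_apply (n : ℕ) (x : c0Sum 𝕜 E) : ccL n x = cc x n := rfl

theorem cc_sum {m : ℕ} (a : Fin m → 𝕜) (y : Fin m → c0Sum 𝕜 E) (n : ℕ) :
    cc (∑ j, a j • y j) n = ∑ j, a j • cc (y j) n := by
  simp only [← ccL_apply, map_sum, map_smul]

theorem exists_cc (g : ∀ n, E n) (h : Tendsto (fun n => ‖g n‖) atTop (𝓝 0)) :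
    ∃ x : c0Sum 𝕜 E, ∀ n, cc x n = g n :=
  ⟨⟨⟨g, memℓp_infty h.bddAbove_range⟩, h⟩, fun _ => rfl⟩

/-- modify the first `N` coordinates -/
theorem exists_modify (N : ℕ) (g : ∀ n, E n) (y : c0Sum 𝕜 E) :
    ∃ x : c0Sum 𝕜 E, (∀ n < N, cc x n = g n) ∧ (∀ n, N ≤ n → cc x n = cc y n) := by
  obtain ⟨x, hx⟩ := exists_cc (𝕜 := 𝕜) (fun n => if n < N then g n else cc y n) (by
    refine (cc_tendsto y).congr' ?_
    filter_upwards [eventually_ge_atTop N] with n hn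
    rw [if_neg (not_lt.2 hn)])
  refine ⟨x, fun n hn => ?_, fun n hn => ?_⟩
  · rw [hx, if_pos hn]
  · rw [hx, if_neg (not_lt.2 hn)]

theorem tail_step (f : c0Sum 𝕜 E →L[𝕜] 𝕜) {ε : ℝ} (hε : 0 < ε)
    (H : ∀ N : ℕ, ∃ y : c0Sum 𝕜 E, ‖y‖ ≤ 2 ∧ (∀ n < N, cc y n = 0) ∧ ε ≤ ‖f y‖) (k : ℕ) :
    ∃ (z : c0Sum 𝕜 E) (M : ℕ), ‖z‖ ≤ 2 ∧ (∀ n, M ≤ n → cc z n = 0) ∧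
      k * (ε / 2) ≤ RCLike.re (f z) := by
  induction k with
  | zero => exact ⟨0, 0, by simp, fun n _ => rfl, by simp⟩
  | succ k ih =>
    obtain ⟨z, M, hz, hzM, hfz⟩ := ih
    obtain ⟨y, hy, hyM, hfy⟩ := H M
    set η : ℝ := ε / 2 / (‖f‖ + 1) with hη
    have hη0 : 0 < η := by positivity
    obtain ⟨K, hK⟩ := eventually_atTop.1 ((cc_tendsto y).eventually (gt_mem_nhds hη0))
    -- the tail and the head of `y`
    obtain ⟨t, ht1, ht2⟩ := exists_modify K (fun _ => 0) y
    have htn : ‖t‖ ≤ η := norm_le_cc _ _ fun n => by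
      rcases lt_or_ge n K with h | h
      · rw [ht1 n h, norm_zero]; exact hη0.le
      · rw [ht2 n h]; exact (hK n h).le
    have hft : ‖f t‖ ≤ ε / 2 := by
      calc ‖f t‖ ≤ ‖f‖ * ‖t‖ := f.le_opNorm t
        _ ≤ (‖f‖ + 1) * η := by gcongr; linarith
        _ = ε / 2 := by rw [hη]; field_simp
    have hs : ε / 2 ≤ ‖f (y - t)‖ := by
      rw [map_sub]
      have := norm_sub_norm_le (f y) (f t)
      linarith
    obtain ⟨c, hc, hcf⟩ := RCLike.exists_norm_eq_mul_self (f (y - t))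
    have hsc : ∀ n, ‖cc (c • (y - t)) n‖ ≤ 2 := fun n => by
      rw [cc_smul, norm_smul, hc, one_mul, cc_sub]
      rcases lt_or_ge n K with h | h
      · rw [ht1 n h, sub_zero]; exact (cc_norm_le y n).trans hy
      · rw [ht2 n h]; simp
    refine ⟨z + c • (y - t), max M K, norm_le_cc _ _ fun n => ?_, fun n hn => ?_, ?_⟩
    · rw [cc_add]
      rcases lt_or_ge n M with h | h
      · have : cc (c • (y - t)) n = 0 := by
          rw [cc_smul, cc_sub]
          rcases lt_or_ge n K with h' | h'
          · rw [ht1 n h', hyM n h]; simp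
          · rw [ht2 n h']; simp
        rw [this, add_zero]
        exact (cc_norm_le z n).trans hz
      · rw [hzM n h, zero_add]; exact hsc n
    · rw [cc_add, hzM n (le_trans (le_max_left _ _) hn), cc_smul, cc_sub,
        ht2 n (le_trans (le_max_right _ _) hn)]
      simp
    · rw [map_add, map_smul, smul_eq_mul, ← hcf, map_add, RCLike.ofReal_re]
      push_cast
      linarith

theorem tail_small (f : c0Sum 𝕜 E →L[𝕜] 𝕜) {ε : ℝ} (hε : 0 < ε) :
    ∃ N : ℕ, ∀ y : c0Sum 𝕜 E, ‖y‖ ≤ 2 → (∀ n < N, cc y n = 0) → ‖f y‖ < ε := by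
  by_contra! H
  obtain ⟨k, hk⟩ := exists_nat_gt (‖f‖ * 2 / (ε / 2))
  obtain ⟨z, M, hz, -, hfz⟩ := tail_step f hε H k
  rw [div_lt_iff₀ (by positivity)] at hk
  have h1 : RCLike.re (f z) ≤ ‖f z‖ := RCLike.re_le_norm _
  have h2 : ‖f z‖ ≤ ‖f‖ * ‖z‖ := f.le_opNorm z
  have h3 : ‖f‖ * ‖z‖ ≤ ‖f‖ * 2 := by gcongr
  linarith

theorem fun_near (f : c0Sum 𝕜 E →L[𝕜] 𝕜) (u : c0Sum 𝕜 E) (hu : ‖u‖ ≤ 1) (S : Set 𝕜)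
    (hS : S ∈ 𝓝 (f u)) :
    ∀ᶠ N : ℕ in atTop, ∀ᶠ ε : ℝ in 𝓝[>] 0, ∀ y : c0Sum 𝕜 E, ‖y‖ ≤ 1 →
      (∀ n < N, ‖cc y n - cc u n‖ < ε) → f y ∈ S := by
  obtain ⟨η, hη, hηS⟩ := Metric.mem_nhds_iff.1 hS
  obtain ⟨N₀, hN₀⟩ := tail_small f (half_pos hη)
  filter_upwards [eventually_ge_atTop N₀] with N hN
  have hpos : 0 < η / 2 / (‖f‖ + 1) := by positivity
  filter_upwards [Ioo_mem_nhdsGT hpos] with ε hε y hy hyu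
  apply hηS
  rw [mem_ball, dist_eq_norm, ← map_sub]
  obtain ⟨t, ht1, ht2⟩ := exists_modify N (fun _ => 0) (y - u)
  have htn : ‖t‖ ≤ 2 := norm_le_cc _ _ fun n => by
    rcases lt_or_ge n N with h | h
    · rw [ht1 n h, norm_zero]; norm_num
    · rw [ht2 n h]
      refine (cc_norm_le _ n).trans ((norm_sub_le _ _).trans ?_)
      linarith
  have hft : ‖f t‖ < η / 2 := hN₀ t htn fun n hn => ht1 n (hn.trans_le hN)
  have hhn : ‖y - u - t‖ ≤ ε := norm_le_cc _ _ fun n => by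
    rw [cc_sub]
    rcases lt_or_ge n N with h | h
    · rw [ht1 n h, sub_zero, cc_sub]; exact (hyu n h).le
    · rw [ht2 n h, sub_self, norm_zero]; exact hε.1.le
  have hfh : ‖f (y - u - t)‖ ≤ η / 2 := by
    calc ‖f (y - u - t)‖ ≤ ‖f‖ * ‖y - u - t‖ := f.le_opNorm _
      _ ≤ (‖f‖ + 1) * (η / 2 / (‖f‖ + 1)) := by
        gcongr
        · linarith
        · exact hhn.trans hε.2.le
      _ = η / 2 := by field_simp
  have : f (y - u) = f (y - u - t) + f t := by rw [← map_add, sub_add_cancel]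
  rw [this]
  have := norm_add_le (f (y - u - t)) (f t)
  linarith

theorem weak_near (V : Set (c0Sum 𝕜 E)) (hV : IsOpen[weakTop 𝕜 (c0Sum 𝕜 E)] V)
    (u : c0Sum 𝕜 E) (hu : ‖u‖ ≤ 1) (huV : u ∈ V) :
    ∀ᶠ N : ℕ in atTop, ∀ᶠ ε : ℝ in 𝓝[>] 0, ∀ y : c0Sum 𝕜 E, ‖y‖ ≤ 1 →
      (∀ n < N, ‖cc y n - cc u n‖ < ε) → y ∈ V := by
  obtain ⟨W, hW, rfl⟩ := isOpen_induced_iff.1 hV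
  obtain ⟨I, s, hs, hsW⟩ := isOpen_pi_iff.1 hW _ huV
  have h1 : ∀ᶠ N : ℕ in atTop, ∀ f ∈ I, ∀ᶠ ε : ℝ in 𝓝[>] 0, ∀ y : c0Sum 𝕜 E, ‖y‖ ≤ 1 →
      (∀ n < N, ‖cc y n - cc u n‖ < ε) → f y ∈ s f :=
    (eventually_all_finset I).2 fun f hf =>
      fun_near f u hu (s f) ((hs f hf).1.mem_nhds (hs f hf).2)
  filter_upwards [h1] with N hN
  filter_upwards [(eventually_all_finset I).2 hN] with ε hε y hy hyu
  exact hsW fun f hf => hε f hf y hy hyu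

theorem weak_continuous_fun {F : Type*} [NormedAddCommGroup F] [NormedSpace 𝕜 F]
    (f : F →L[𝕜] 𝕜) : @Continuous _ _ (weakTop 𝕜 F) _ (fun x : F => f x) :=
  @Continuous.comp F ((F →L[𝕜] 𝕜) → 𝕜) 𝕜 (weakTop 𝕜 F) _ _
    (fun (x : F) (g : F →L[𝕜] 𝕜) => g x) (fun p => p f)
    (continuous_apply f) continuous_induced_dom

theorem weak_continuous_cc [∀ n, FiniteDimensional 𝕜 (E n)] (n : ℕ) :
    @Continuous _ _ (weakTop 𝕜 (c0Sum 𝕜 E)) _ (fun x : c0Sum 𝕜 E => cc x n) := by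
  let b := Module.finBasis 𝕜 (E n)
  have h2 : (fun x : c0Sum 𝕜 E => cc x n) =
      fun x => ∑ i, (LinearMap.toContinuousLinearMap (b.coord i)) (ccL n x) • b i := by
    funext x
    exact (b.sum_repr (cc x n)).symm
  have h3 := fun i => weak_continuous_fun
    ((LinearMap.toContinuousLinearMap (b.coord i)).comp (ccL (𝕜 := 𝕜) (E := E) n))
  rw [h2]
  let _ := weakTop 𝕜 (c0Sum 𝕜 E)
  refine continuous_finsetSum _ fun i _ => ?_
  exact (h3 i).smul continuous_const

theorem hasCoN_one {F : Type*} [NormedAddCommGroup F] [NormedSpace 𝕜 F] (x : F) :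
    HasCoN 𝕜 1 x := by
  intro xs lam hxs hl hs hx ε hε
  have hl1 : lam 0 = 1 := by simpa using hs
  have hx1 : x = xs 0 := by simpa [hl1] using hx
  refine ⟨ε, hε, fun _ u => u, fun _ => continuous_subtype_val, fun u => ⟨fun j => ?_, ?_, ?_⟩⟩
  · simpa using u.2.2
  · simp [hl1]
  · intro j
    have := u.2.1
    rw [mem_ball, dist_eq_norm] at this
    rw [Subsingleton.elim j 0]
    exact lt_of_eq_of_lt (congrArg (fun a => ‖(u : F) - a‖) hx1.symm) this

theorem norm_comb_le {F : Type*} [NormedAddCommGroup F] [NormedSpace 𝕜 F] {m : ℕ}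
    (lam : Fin m → ℝ) (hl : ∀ j, 0 < lam j) (hs : ∑ j, lam j = 1) (u : Fin m → F)
    (hu : ∀ j, ‖u j‖ ≤ 1) : ‖∑ j, ((lam j : ℝ) : 𝕜) • u j‖ ≤ 1 := by
  refine (norm_sum_le _ _).trans ?_
  rw [← hs]
  refine Finset.sum_le_sum fun j _ => ?_
  rw [norm_smul, RCLike.norm_ofReal, abs_of_pos (hl j)]
  exact mul_le_of_le_one_right (hl j).le (hu j)

end C0Aux

/-- The `c₀`-sum of a sequence of finite dimensional Banach spaces, each
with property (co), has property CWO. -/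
theorem stmt18 {𝕜 : Type*} [RCLike 𝕜] (E : ℕ → Type*) [∀ n, NormedAddCommGroup (E n)]
    [∀ n, NormedSpace 𝕜 (E n)] [∀ n, FiniteDimensional 𝕜 (E n)]
    (hco : ∀ n, PropCo 𝕜 (E n)) :
    PropCWO 𝕜 ↥(c0Sum 𝕜 E) := by
  intro m U lam hU hl hs
  have hm : m ≠ 0 := by
    rintro rfl
    simp at hs
  have hcoN : ∀ n (x : E n), ‖x‖ ≤ 1 → HasCoN 𝕜 m x := by
    intro n x hx
    rcases Nat.lt_or_ge m 2 with h | h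
    · obtain rfl : m = 1 := by omega
      exact hasCoN_one x
    · exact hco n x hx m h
  have hball : ConvComb 𝕜 lam U ⊆ closedBall 0 1 := by
    rintro x ⟨u, hu, rfl⟩
    rw [mem_closedBall_zero_iff]
    exact norm_comb_le lam hl hs u fun j => by simpa using (hU j).1 (hu j)
  have key : ∀ x ∈ ConvComb 𝕜 lam U, RelWeakInterior 𝕜 (ConvComb 𝕜 lam U) x := by
    rintro x ⟨u, hu, hx⟩
    have hu1 : ∀ j, ‖u j‖ ≤ 1 := fun j => by simpa using (hU j).1 (hu j)
    have h1 : ∀ᶠ N : ℕ in Filter.atTop, ∀ j, ∀ᶠ ε : ℝ in 𝓝[>] 0, ∀ y : c0Sum 𝕜 E, ‖y‖ ≤ 1 →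
        (∀ n < N, ‖cc y n - cc (u j) n‖ < ε) → y ∈ U j := by
      refine Filter.eventually_all.2 fun j => ?_
      obtain ⟨-, V, hV, hUV⟩ := hU j
      have huV : u j ∈ V := by
        have := hu j
        rw [hUV] at this
        exact this.1
      filter_upwards [weak_near V hV (u j) (hu1 j) huV] with N hN
      filter_upwards [hN] with ε hε y hy hyu
      rw [hUV]
      exact ⟨hε y hy hyu, by simpa using hy⟩
    obtain ⟨N, hN⟩ := h1.exists
    obtain ⟨ε, hε, hε0⟩ := ((Filter.eventually_all.2 hN).and self_mem_nhdsWithin).exists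
    have hxn : ∀ n, cc x n = ∑ j, ((lam j : ℝ) : 𝕜) • cc (u j) n := fun n => by
      rw [hx, cc_sum]
    have h2 := fun n => hcoN n (cc x n)
      (by rw [hxn]; exact norm_comb_le lam hl hs _ fun j => (cc_norm_le _ n).trans (hu1 j))
      (fun j => cc (u j) n) lam (fun j => (cc_norm_le _ n).trans (hu1 j)) hl hs (hxn n) ε hε0
    choose δ hδ v hvc hv using h2
    refine ⟨⋂ n ∈ Finset.range N, (fun y : c0Sum 𝕜 E => cc y n) ⁻¹' ball (cc x n) (δ n), ?_, ?_, ?_⟩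
    · letI := weakTop 𝕜 (c0Sum 𝕜 E)
      exact isOpen_biInter_finset fun n _ => isOpen_ball.preimage (weak_continuous_cc n)
    · simp only [Set.mem_iInter]
      intro n _
      exact mem_ball_self (hδ n)
    · rintro y ⟨hy, hyb⟩
      have hyb1 : ‖y‖ ≤ 1 := by simpa using hyb
      have hy' : ∀ n < N, cc y n ∈ ball (cc x n) (δ n) ∩ closedBall 0 1 := fun n hn =>
        ⟨by simpa using Set.mem_iInter₂.1 hy n (Finset.mem_range.2 hn),
          by simpa using (cc_norm_le y n).trans hyb1⟩
      classical
      have h3 : ∀ j, ∃ z : c0Sum 𝕜 E,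
          (∀ n (hn : n < N), cc z n = v n j ⟨cc y n, hy' n hn⟩) ∧
          (∀ n, N ≤ n → cc z n = cc y n) := fun j => by
        obtain ⟨z, hz1, hz2⟩ := exists_modify N
          (fun n => if hn : n < N then v n j ⟨cc y n, hy' n hn⟩ else 0) y
        refine ⟨z, fun n hn => ?_, hz2⟩
        rw [hz1 n hn, dif_pos hn]
      choose z hz1 hz2 using h3
      refine ⟨z, fun j => hε j (z j) (norm_le_cc _ _ fun n => ?_) fun n hn => ?_,
        cc_ext fun n => ?_⟩
      · rcases lt_or_ge n N with h | h
        · rw [hz1 j n h]; exact (hv n _).1 j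
        · rw [hz2 j n h]; exact (cc_norm_le y n).trans hyb1
      · rw [hz1 j n hn]; exact (hv n _).2.2 j
      · rw [cc_sum]
        rcases lt_or_ge n N with h | h
        · simp only [hz1 _ n h]; exact (hv n ⟨cc y n, hy' n h⟩).2.1
        · simp only [hz2 _ n h]
          rw [← Finset.sum_smul, ← RCLike.ofReal_sum, hs]
          simp
  refine ⟨⋃₀ {V | IsOpen[weakTop 𝕜 (c0Sum 𝕜 E)] V ∧ V ∩ closedBall 0 1 ⊆ ConvComb 𝕜 lam U},
    ?_, ?_⟩
  · letI := weakTop 𝕜 (c0Sum 𝕜 E)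
    exact isOpen_sUnion fun V hV => hV.1
  · ext x
    constructor
    · intro hx
      obtain ⟨V, hV, hxV, hVC⟩ := key x hx
      exact ⟨⟨V, ⟨hV, hVC⟩, hxV⟩, hball hx⟩
    · rintro ⟨⟨V, ⟨-, hVC⟩, hxV⟩, hxb⟩
      exact hVC ⟨hxV, hxb⟩
end

section
/- Let μ be a non-zero σ-finite countably additive non-negative measure on a σ-algebra Σ of a non-empty set Ω. Then the real space L_1(μ) has property CWO-S: for every finite convex combination C of relatively weakly open subsets of the closed unit ball B_{L_1(μ)}, every x ∈ C with ‖x‖ = 1 is an interior point of C in the relative weak topology of B_{L_1(μ)}. -/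
open Metric Topology

section

open MeasureTheory

lemma aux_weak_isOpen_iff {E : Type*} [NormedAddCommGroup E] [NormedSpace ℝ E] (V : Set E) :
    IsOpen[weakTop ℝ E] V ↔ ∃ O : Set ((E →L[ℝ] ℝ) → ℝ), IsOpen O ∧
      (fun (x : E) (f : E →L[ℝ] ℝ) => f x) ⁻¹' O = V :=
  isOpen_induced_iff

lemma aux_weak_shrink {E : Type*} [NormedAddCommGroup E] [NormedSpace ℝ E] (V : Set E)
    (hV : IsOpen[weakTop ℝ E] V) (x : E) (hx : x ∈ V) :
    ∃ W : Set E, IsOpen[weakTop ℝ E] W ∧ x ∈ W ∧ ∃ ε : ℝ, 0 < ε ∧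
      ∀ w ∈ W, ∀ d : E, ‖d‖ < ε → w + d ∈ V := by
  obtain ⟨O, hO, rfl⟩ := (aux_weak_isOpen_iff V).1 hV
  have hc : Continuous (fun p : ((E →L[ℝ] ℝ) → ℝ) × E => fun f : E →L[ℝ] ℝ => p.1 f + f p.2) := by
    fun_prop
  have h1 := hO.preimage hc
  obtain ⟨A, B, hA, hB, hxA, h0B, hAB⟩ :=
    isOpen_prod_iff.1 h1 (fun f => f x) (0 : E) (by simpa using hx)
  obtain ⟨ε, hε, hball⟩ := Metric.isOpen_iff.1 hB 0 h0B
  refine ⟨_, (aux_weak_isOpen_iff _).2 ⟨A, hA, rfl⟩, hxA, ε, hε, ?_⟩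
  intro w hw d hd
  have : ((fun f : E →L[ℝ] ℝ => f w), d) ∈ A ×ˢ B := ⟨hw, hball (by simpa using hd)⟩
  have h2 := hAB this
  simpa using h2

lemma aux_weak_preimage {E : Type*} [NormedAddCommGroup E] [NormedSpace ℝ E] (W : Set E)
    (hW : IsOpen[weakTop ℝ E] W) (M : E →L[ℝ] E) : IsOpen[weakTop ℝ E] (M ⁻¹' W) := by
  obtain ⟨O, hO, rfl⟩ := (aux_weak_isOpen_iff W).1 hW
  refine (aux_weak_isOpen_iff _).2
    ⟨(fun (p : (E →L[ℝ] ℝ) → ℝ) (f : E →L[ℝ] ℝ) => p (f.comp M)) ⁻¹' O, hO.preimage ?_, rfl⟩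
  fun_prop

lemma aux_weak_half {E : Type*} [NormedAddCommGroup E] [NormedSpace ℝ E]
    (f : E →L[ℝ] ℝ) (r : ℝ) : IsOpen[weakTop ℝ E] {y | f y < r} :=
  (aux_weak_isOpen_iff _).2 ⟨{p | p f < r}, isOpen_lt (by fun_prop) (by fun_prop), rfl⟩

lemma aux_abstract {E : Type*} [NormedAddCommGroup E] [NormedSpace ℝ E] {n : ℕ}
    (U : Fin n → Set E) (lam : Fin n → ℝ) (hU : ∀ j, RelWeakOpen ℝ (U j))
    (hl : ∀ j, 0 < lam j) (hl1 : ∑ j, lam j = 1)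
    (x : E) (M : Fin n → E →L[ℝ] E) (φ : Fin n → E →L[ℝ] ℝ) (κ : Fin n → ℝ)
    (hMx : ∀ j, M j x ∈ U j) (hsum : ∀ y, ∑ j, lam j • M j y = y)
    (hnorm : ∀ y, ∑ j, lam j * ‖M j y‖ = ‖y‖)
    (hφ : ∀ j y, ‖y‖ ≤ 1 → ‖M j y‖ ≤ φ j y + κ j) (hφx : ∀ j, φ j x + κ j ≤ 1) :
    RelWeakInterior ℝ (ConvComb ℝ lam U) x := by
  choose hUb V hV hUV using hU
  have hMV : ∀ j, M j x ∈ V j := fun j => by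
    have := hMx j
    rw [hUV j] at this
    exact this.1
  choose W hW hxW ε hε hWV using fun j => aux_weak_shrink (V j) (hV j) (M j x) (hMV j)
  obtain ⟨η, hη0, hη1, hηε⟩ : ∃ η : ℝ, 0 < η ∧ η < 1 ∧ ∀ j, η * (2 / lam j) < ε j := by
    have h1 : ∀ᶠ η : ℝ in 𝓝[>] 0, 0 < η := eventually_mem_nhdsWithin
    have h2 : ∀ᶠ η : ℝ in 𝓝[>] 0, η < 1 := nhdsWithin_le_nhds (Iio_mem_nhds one_pos)
    have h3 : ∀ᶠ η : ℝ in 𝓝[>] 0, ∀ j, η * (2 / lam j) < ε j := by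
      rw [Filter.eventually_all]
      intro j
      apply Filter.Eventually.filter_mono nhdsWithin_le_nhds
      have : ContinuousAt (fun η : ℝ => η * (2 / lam j)) 0 := by fun_prop
      exact this.eventually_lt_const (by simpa using hε j)
    exact (h1.and (h2.and h3)).exists
  set c := 1 - η with hc
  have hc0 : 0 < c := by linarith
  have hc1 : 1 < 1 / c := by rw [lt_div_iff₀ hc0]; linarith
  refine ⟨⋂ j, (M j ⁻¹' W j ∩ {y | φ j y < 1 / c - κ j}), ?_, ?_, ?_⟩
  · refine @isOpen_iInter_of_finite _ _ (weakTop ℝ E) _ _ fun j => ?_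
    exact @IsOpen.inter _ (weakTop ℝ E) _ _ (aux_weak_preimage _ (hW j) _) (aux_weak_half _ _)
  · simp only [Set.mem_iInter]
    intro j
    refine ⟨hxW j, ?_⟩
    have := hφx j
    show φ j x < 1 / c - κ j
    linarith
  · rintro y ⟨hy, hyB⟩
    simp only [Set.mem_iInter] at hy
    have hN : ‖y‖ ≤ 1 := by simpa using hyB
    have hN0 := norm_nonneg y
    have ha : ∀ j, c * ‖M j y‖ ≤ 1 := fun j => by
      have h1 := hφ j y hN
      have h2 : φ j y < 1 / c - κ j := (hy j).2
      have h3 : ‖M j y‖ ≤ 1 / c := by linarith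
      rw [le_div_iff₀ hc0] at h3
      linarith
    have hcN : 0 < 1 - c * ‖y‖ := by nlinarith
    set t := η / (1 - c * ‖y‖) with ht
    have ht0 : 0 ≤ t := by positivity
    have htN : t * ‖y‖ ≤ 1 := by
      rw [ht, div_mul_eq_mul_div, div_le_one hcN]
      nlinarith
    have htη : t * (1 - c * ‖y‖) = η := by rw [ht]; field_simp
    set β : Fin n → ℝ := fun j => (1 - c * ‖M j y‖) * t with hβ
    have hβ0 : ∀ j, 0 ≤ β j := fun j => mul_nonneg (by linarith [ha j]) ht0
    have hβsum : ∑ j, lam j * β j = η := by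
      calc ∑ j, lam j * β j = t * (∑ j, lam j - c * ∑ j, lam j * ‖M j y‖) := by
            rw [Finset.mul_sum, ← Finset.sum_sub_distrib, Finset.mul_sum]
            refine Finset.sum_congr rfl fun j _ => ?_
            simp only [hβ]; ring
        _ = η := by rw [hl1, hnorm, htη]
    have hβle : ∀ j, lam j * β j ≤ η := fun j => by
      rw [← hβsum]
      exact Finset.single_le_sum (f := fun j => lam j * β j)
        (fun i _ => mul_nonneg (hl i).le (hβ0 i)) (Finset.mem_univ j)
    have hale : ∀ j, lam j * ‖M j y‖ ≤ ‖y‖ := fun j => by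
      refine le_of_le_of_eq ?_ (hnorm y)
      exact Finset.single_le_sum (f := fun j => lam j * ‖M j y‖)
        (fun i _ => mul_nonneg (hl i).le (norm_nonneg _)) (Finset.mem_univ j)
    refine ⟨fun j => M j y + ((-η) • M j y + β j • y), fun j => ?_, ?_⟩
    · rw [hUV j]
      constructor
      · refine hWV j _ (hy j).1 _ (lt_of_le_of_lt ?_ (hηε j))
        refine (norm_add_le _ _).trans ?_
        rw [norm_smul, norm_smul, norm_neg, Real.norm_of_nonneg hη0.le,
          Real.norm_of_nonneg (hβ0 j), ← mul_div_assoc, le_div_iff₀ (hl j)]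
        have h1 := hβle j
        have h2 := hale j
        have h3 : lam j * β j * ‖y‖ ≤ η * 1 := mul_le_mul h1 hN hN0 hη0.le
        have h4 : η * (lam j * ‖M j y‖) ≤ η * 1 := by gcongr; linarith
        linarith
      · rw [mem_closedBall_zero_iff]
        have e : M j y + ((-η) • M j y + β j • y) = c • M j y + β j • y := by
          rw [hc, sub_smul, one_smul, neg_smul]; abel
        show ‖M j y + ((-η) • M j y + β j • y)‖ ≤ 1
        rw [e]
        refine (norm_add_le _ _).trans ?_
        rw [norm_smul, norm_smul, Real.norm_of_nonneg hc0.le, Real.norm_of_nonneg (hβ0 j)]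
        have h1 : (1 - c * ‖M j y‖) * (t * ‖y‖) ≤ (1 - c * ‖M j y‖) * 1 :=
          mul_le_mul_of_nonneg_left htN (by linarith [ha j])
        simp only [hβ]
        linarith
    · simp only [RCLike.ofReal_real_eq_id, id]
      have : ∀ j, lam j • (M j y + ((-η) • M j y + β j • y)) =
          lam j • M j y + ((-η) • (lam j • M j y) + (lam j * β j) • y) := fun j => by
        module
      simp only [this]
      rw [Finset.sum_add_distrib, Finset.sum_add_distrib, ← Finset.smul_sum, ← Finset.sum_smul,
        hsum, hβsum]
      module

lemma aux_mulOp {Ω : Type*} [MeasurableSpace Ω] (μ : Measure Ω) (h : Ω → ℝ)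
    (hm : AEStronglyMeasurable h μ) (C : ℝ) (hC : ∀ᵐ t ∂μ, ‖h t‖ ≤ C) :
    ∃ M : Lp ℝ 1 μ →L[ℝ] Lp ℝ 1 μ, ∀ y : Lp ℝ 1 μ, M y =ᵐ[μ] fun t => h t * y t := by
  have hi : ∀ y : Lp ℝ 1 μ, Integrable (fun t => h t * y t) μ := fun y =>
    (L1.integrable_coeFn y).bdd_mul hm hC
  let L : Lp ℝ 1 μ →ₗ[ℝ] Lp ℝ 1 μ :=
    { toFun := fun y => (hi y).toL1 _
      map_add' := by
        intro y z
        rw [← Integrable.toL1_add]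
        rw [Integrable.toL1_eq_toL1_iff]
        filter_upwards [Lp.coeFn_add y z] with t ht
        rw [ht, Pi.add_apply, Pi.add_apply, mul_add]
      map_smul' := by
        intro r y
        rw [RingHom.id_apply, ← Integrable.toL1_smul]
        rw [Integrable.toL1_eq_toL1_iff]
        filter_upwards [Lp.coeFn_smul r y] with t ht
        rw [ht, Pi.smul_apply, smul_eq_mul, smul_eq_mul]
        ring }
  refine ⟨L.mkContinuous C fun y => ?_, fun y => (hi y).coeFn_toL1⟩
  rw [L1.norm_eq_integral_norm, L1.norm_eq_integral_norm, ← integral_const_mul]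
  refine integral_mono_ae (L1.integrable_coeFn _).norm ((L1.integrable_coeFn _).norm.const_mul _) ?_
  filter_upwards [hC, (hi y).coeFn_toL1] with t ht h2
  show ‖((hi y).toL1 _ : Lp ℝ 1 μ) t‖ ≤ _
  rw [h2, norm_mul]
  gcongr

end

open MeasureTheory in
/-- For a non-zero σ-finite measure `μ`, the real space `L¹(μ)` has
property CWO-S. -/
theorem stmt19 {Ω : Type*} [MeasurableSpace Ω] [Nonempty Ω]
    (μ : Measure Ω) [SigmaFinite μ] (hμ : μ ≠ 0) :
    PropCWOS ℝ (Lp ℝ 1 μ) := by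
  intro n U lam hU hl hl1 x hx hx1
  obtain ⟨u, hu, hxu⟩ := hx
  simp only [RCLike.ofReal_real_eq_id, id] at hxu
  have hI : ∀ y : Lp ℝ 1 μ, Integrable y μ := fun y => L1.integrable_coeFn y
  have hu1 : ∀ j, ‖u j‖ ≤ 1 := fun j => by simpa using (hU j).1 (hu j)
  have hxae : ∀ᵐ t ∂μ, x t = ∑ j, lam j * u j t := by
    have h1 : x =ᵐ[μ] ∑ j, (lam j • u j : Lp ℝ 1 μ) := by rw [hxu]; exact Lp.coeFn_finsetSum _ _
    have h2 : ∀ᵐ t ∂μ, ∀ j, (lam j • u j : Lp ℝ 1 μ) t = lam j * u j t := by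
      rw [ae_all_iff]
      intro j
      filter_upwards [Lp.coeFn_smul (lam j) (u j)] with t ht
      simp [ht]
    filter_upwards [h1, h2] with t h1 h2
    rw [h1, Finset.sum_apply]
    exact Finset.sum_congr rfl fun j _ => h2 j
  have hIs : Integrable (fun t => ∑ j, lam j * |u j t|) μ :=
    integrable_finsetSum _ fun j _ => (hI (u j)).abs.const_mul _
  have habs : ∀ᵐ t ∂μ, |x t| = ∑ j, lam j * |u j t| := by
    have hnn : ∀ᵐ t ∂μ, 0 ≤ (∑ j, lam j * |u j t|) - |x t| := by
      filter_upwards [hxae] with t ht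
      rw [ht, sub_nonneg]
      refine (Finset.abs_sum_le_sum_abs _ _).trans (le_of_eq ?_)
      exact Finset.sum_congr rfl fun j _ => by rw [abs_mul, abs_of_pos (hl j)]
    have hint : ∫ t, ((∑ j, lam j * |u j t|) - |x t|) ∂μ = 0 := by
      refine le_antisymm ?_ (integral_nonneg_of_ae hnn)
      rw [integral_sub hIs (hI x).abs, integral_finsetSum _
        fun j _ => (hI (u j)).abs.const_mul _]
      simp only [integral_const_mul, ← Real.norm_eq_abs, ← L1.norm_eq_integral_norm]
      rw [hx1, ← hl1, sub_nonpos]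
      exact Finset.sum_le_sum fun j _ => by nlinarith [hl j, hu1 j]
    rw [integral_eq_zero_iff_of_nonneg_ae hnn (hIs.sub (hI x).abs)] at hint
    filter_upwards [hint] with t ht
    simp only [Pi.zero_apply] at ht
    linarith
  -- the multipliers
  set h : Fin n → Ω → ℝ := fun j t => if x t = 0 then 1 else |u j t| / |x t| with hh
  have hxm : Measurable (x : Ω → ℝ) := (Lp.stronglyMeasurable x).measurable
  have hum : ∀ j, Measurable (u j : Ω → ℝ) := fun j => (Lp.stronglyMeasurable (u j)).measurable
  have hhm : ∀ j, Measurable (h j) := fun j =>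
    Measurable.ite (hxm (measurableSet_singleton 0)) measurable_const ((hum j).abs.div hxm.abs)
  have hh0 : ∀ j t, 0 ≤ h j t := fun j t => by simp only [hh]; split_ifs <;> positivity
  have hhsum : ∀ᵐ t ∂μ, ∑ j, lam j * h j t = 1 := by
    filter_upwards [habs] with t ht
    simp only [hh]
    split_ifs with h0
    · simpa using hl1
    · simp only [← mul_div_assoc]
      rw [← Finset.sum_div, ← ht, div_self (by positivity)]
  have hhle : ∀ᵐ t ∂μ, ∀ j, h j t ≤ 1 / lam j := by
    filter_upwards [hhsum] with t ht j
    rw [le_div_iff₀ (hl j), mul_comm, ← ht]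
    exact Finset.single_le_sum (f := fun j => lam j * h j t)
      (fun i _ => mul_nonneg (hl i).le (hh0 i t)) (Finset.mem_univ j)
  have hhx : ∀ᵐ t ∂μ, ∀ j, h j t * |x t| = |u j t| ∧ h j t * x t = u j t := by
    filter_upwards [habs, hxae] with t h1 h2 j
    have hterm : ∀ σ : ℝ, (∀ i, σ * u i t ≤ |u i t|) → |x t| = σ * x t →
        ∀ i, |u i t| = σ * u i t := by
      intro σ hσ hxσ i
      have hz : ∑ j, lam j * (|u j t| - σ * u j t) = 0 := by
        simp only [mul_sub, Finset.sum_sub_distrib]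
        rw [← h1, hxσ, h2, Finset.mul_sum, sub_eq_zero]
        exact Finset.sum_congr rfl fun j _ => by ring
      have := (Finset.sum_eq_zero_iff_of_nonneg
        (fun i _ => mul_nonneg (hl i).le (sub_nonneg.2 (hσ i)))).1 hz i (Finset.mem_univ i)
      have := (mul_eq_zero.1 this).resolve_left (hl i).ne'
      linarith
    have hp : 0 ≤ x t → ∀ i, |u i t| = 1 * u i t := fun hx0 =>
      hterm 1 (fun i => by simpa using le_abs_self _) (by simpa using hx0)
    have hn : x t ≤ 0 → ∀ i, |u i t| = -1 * u i t := fun hx0 =>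
      hterm (-1) (fun i => by simpa using neg_le_abs _) (by simpa using hx0)
    simp only [hh]
    split_ifs with h0
    · have e1 := hp h0.ge j
      have e2 := hn h0.le j
      rw [h0]
      constructor
      · simp; linarith
      · linarith
    · have hne : |x t| ≠ 0 := by positivity
      refine ⟨by field_simp, ?_⟩
      rcases le_total 0 (x t) with hx0 | hx0
      · rw [hp hx0 j, abs_of_nonneg hx0]; field_simp
      · rw [hn hx0 j, abs_of_nonpos hx0]; field_simp
  set s : Ω → ℝ := fun t => SignType.sign (x t) with hs
  have hsx : ∀ t, s t * x t = |x t| := fun t => sign_mul_self _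
  have hs1 : ∀ t, |s t| ≤ 1 := fun t => by
    simp only [hs]
    rcases lt_trichotomy (x t) 0 with h | h | h <;> simp [h]
  have hsm : Measurable s := by
    have : s = fun t => if 0 < x t then 1 else if x t < 0 then -1 else 0 := by
      funext t
      simp only [hs, sign_apply]
      split_ifs <;> simp
    rw [this]
    exact Measurable.ite (measurableSet_lt measurable_const hxm) measurable_const
      (Measurable.ite (measurableSet_lt hxm measurable_const) measurable_const measurable_const)
  have hM : ∀ j, ∃ M : Lp ℝ 1 μ →L[ℝ] Lp ℝ 1 μ, ∀ y : Lp ℝ 1 μ,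
      M y =ᵐ[μ] fun t => h j t * y t := fun j => by
    refine aux_mulOp μ (h j) (hhm j).aestronglyMeasurable (1 / lam j) ?_
    filter_upwards [hhle] with t ht
    rw [Real.norm_of_nonneg (hh0 j t)]
    exact ht j
  have hP : ∀ j, ∃ M : Lp ℝ 1 μ →L[ℝ] Lp ℝ 1 μ, ∀ y : Lp ℝ 1 μ,
      M y =ᵐ[μ] fun t => ((h j t - 1 / lam j) * s t) * y t := fun j => by
    refine aux_mulOp μ (fun t => (h j t - 1 / lam j) * s t)
      (((hhm j).sub measurable_const).mul hsm).aestronglyMeasurable (1 / lam j) ?_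
    filter_upwards [hhle] with t ht
    rw [norm_mul, Real.norm_eq_abs, Real.norm_eq_abs]
    have h1 : |h j t - 1 / lam j| ≤ 1 / lam j := by
      rw [abs_le]; constructor <;> linarith [hh0 j t, ht j, one_div_pos.2 (hl j)]
    calc _ ≤ 1 / lam j * 1 := mul_le_mul h1 (hs1 t) (abs_nonneg _) (one_div_pos.2 (hl j)).le
      _ = _ := mul_one _
  choose M hM using hM
  choose P hP using hP
  have hMn : ∀ j y, ‖M j y‖ = ∫ t, h j t * |y t| ∂μ := fun j y => by
    rw [L1.norm_eq_integral_norm]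
    refine integral_congr_ae ?_
    filter_upwards [hM j y] with t ht
    rw [ht, norm_mul, Real.norm_of_nonneg (hh0 j t), Real.norm_eq_abs]
  have hMi : ∀ j (y : Lp ℝ 1 μ), Integrable (fun t => h j t * |y t|) μ := fun j y => by
    refine (hI (M j y)).norm.congr ?_
    filter_upwards [hM j y] with t ht
    rw [ht, norm_mul, Real.norm_of_nonneg (hh0 j t), Real.norm_eq_abs]
  have hMx : ∀ j, M j x = u j := fun j => by
    refine Lp.ext ?_
    filter_upwards [hM j x, hhx] with t h1 h2
    rw [h1, (h2 j).2]
  have hφ : ∀ j (y : Lp ℝ 1 μ), ((L1.integralCLM (E := ℝ) (μ := μ)).comp (P j)) y =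
      ∫ t, ((h j t - 1 / lam j) * s t) * y t ∂μ := fun j y => by
    rw [ContinuousLinearMap.comp_apply, ← L1.integral_eq, L1.integral_eq_integral]
    exact integral_congr_ae (hP j y)
  have hPi : ∀ j (y : Lp ℝ 1 μ),
      Integrable (fun t => ((h j t - 1 / lam j) * s t) * y t) μ := fun j y =>
    (hI (P j y)).congr (hP j y)
  refine aux_abstract U lam hU hl hl1 x M (fun j => L1.integralCLM.comp (P j))
    (fun j => 1 / lam j) (fun j => ?_) (fun y => ?_) (fun y => ?_) (fun j y hy => ?_) (fun j => ?_)
  · rw [hMx]; exact hu j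
  · refine Lp.ext ?_
    have h2 : ∀ᵐ t ∂μ, ∀ j, (lam j • M j y : Lp ℝ 1 μ) t = lam j * h j t * y t := by
      rw [ae_all_iff]
      intro j
      filter_upwards [Lp.coeFn_smul (lam j) (M j y), hM j y] with t ht h3
      rw [ht, Pi.smul_apply, h3, smul_eq_mul, mul_assoc]
    filter_upwards [Lp.coeFn_finsetSum Finset.univ (fun j => lam j • M j y), h2, hhsum]
      with t h1 h2 h3
    rw [h1, Finset.sum_apply, Finset.sum_congr rfl fun j _ => h2 j, ← Finset.sum_mul, h3, one_mul]
  · simp only [hMn, ← integral_const_mul]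
    rw [← integral_finsetSum _ fun j _ => (hMi j y).const_mul _, L1.norm_eq_integral_norm]
    refine integral_congr_ae ?_
    filter_upwards [hhsum] with t ht
    simp only [← mul_assoc]
    rw [← Finset.sum_mul, ht, one_mul, Real.norm_eq_abs]
  · have key : ‖M j y‖ ≤ (∫ t, ((h j t - 1 / lam j) * s t) * y t ∂μ) + 1 / lam j * ‖y‖ := by
      rw [hMn, L1.norm_eq_integral_norm, ← integral_const_mul,
        ← integral_add (hPi j y) ((hI y).norm.const_mul _)]
      refine integral_mono_ae (hMi j y) ((hPi j y).add ((hI y).norm.const_mul _)) ?_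
      filter_upwards [hhle] with t ht
      rw [Real.norm_eq_abs]
      have h1 : s t * y t ≤ |y t| := by
        refine (le_abs_self _).trans ?_
        rw [abs_mul]
        nlinarith [hs1 t, abs_nonneg (y t)]
      nlinarith [mul_nonneg (sub_nonneg.2 (ht j)) (sub_nonneg.2 h1)]
    have h2 : 1 / lam j * ‖y‖ ≤ 1 / lam j * 1 :=
      mul_le_mul_of_nonneg_left hy (one_div_pos.2 (hl j)).le
    rw [hφ]
    linarith
  · rw [hφ]
    have : ∫ t, ((h j t - 1 / lam j) * s t) * x t ∂μ = ‖u j‖ - 1 / lam j * ‖x‖ := by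
      rw [L1.norm_eq_integral_norm, L1.norm_eq_integral_norm, ← integral_const_mul,
        ← integral_sub (hI _).norm ((hI x).norm.const_mul _)]
      refine integral_congr_ae ?_
      filter_upwards [hhx] with t ht
      rw [Real.norm_eq_abs, Real.norm_eq_abs, ← (ht j).1, mul_assoc, hsx]
      ring
    rw [this, hx1]
    linarith [hu1 j]
end
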